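/- arXiv:1406.4075 — 2 statements merged into one kernel-verified Lean document; each statement's English description precedes it below -/
import Mathlib

section
/- Let T be a regular s-interval exchange transformation on [ℓ,r) and let I be a right admissible semi-interval for T. Then the transformation induced by T on I is a regular s-interval exchange transformation on I. -/
open Set MeasureTheory

noncomputable section

/-- Left endpoint `γ i` of the `i`-th exchanged semi-interval. -/
def sepPt {s : ℕ} (l : ℝ) (len : Fin s → ℝ) (i : Fin s) : ℝ :=
  l + ∑ j ∈ Finset.univ.filter (fun j => j < i), len j

/-- Left endpoint `δ` of the image of the `i`-th exchanged semi-interval. -/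
def imgPt {s : ℕ} (l : ℝ) (len : Fin s → ℝ) (π : Equiv.Perm (Fin s)) (i : Fin s) : ℝ :=
  l + ∑ j ∈ Finset.univ.filter (fun j => π j < π i), len j

/-- `T` is the `s`-interval exchange transformation on `[l,r)` with lengths `len`
and permutation `π`, extended by the identity outside `[l,r)`. -/
def IsIET (s : ℕ) (l r : ℝ) (len : Fin s → ℝ) (π : Equiv.Perm (Fin s))
    (T : Equiv.Perm ℝ) : Prop :=
  l < r ∧ (∀ i, 0 < len i) ∧ (∑ i, len i) = r - l ∧
  (∀ z, z ∉ Set.Ico l r → T z = z) ∧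
  ∀ i : Fin s, ∀ z ∈ Set.Ico (sepPt l len i) (sepPt l len i + len i),
    T z = z + (imgPt l len π i - sepPt l len i)

/-- The two-sided orbit `{T^n z : n ∈ ℤ}`. -/
def orbitZ (T : Equiv.Perm ℝ) (z : ℝ) : Set ℝ := {w | ∃ n : ℤ, (T ^ n) z = w}

/-- Regularity (idoc): the orbits of the nonzero separation points are infinite
and pairwise disjoint. -/
def IsRegularIET (s : ℕ) (l : ℝ) (len : Fin s → ℝ) (T : Equiv.Perm ℝ) : Prop :=
  (∀ i : Fin s, (i : ℕ) ≠ 0 → (orbitZ T (sepPt l len i)).Infinite) ∧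
  (∀ i j : Fin s, (i : ℕ) ≠ 0 → (j : ℕ) ≠ 0 → i ≠ j →
    Disjoint (orbitZ T (sepPt l len i)) (orbitZ T (sepPt l len j)))

/-- Minimality: every (two-sided) orbit of a point of `[l,r)` is dense in `[l,r)`. -/
def IsMinimalOn (T : Equiv.Perm ℝ) (l r : ℝ) : Prop :=
  ∀ z ∈ Set.Ico l r, Set.Ico l r ⊆ closure (orbitZ T z)

/-- First return time of `z` in `I` (defined via `sInf`; meaningful when `T` is minimal). -/
def returnTime (T : Equiv.Perm ℝ) (I : Set ℝ) (z : ℝ) : ℕ :=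
  sInf {n : ℕ | 0 < n ∧ (T ^ n) z ∈ I}

/-- The transformation induced by `T` on `I` (first-return map). -/
def inducedMap (T : Equiv.Perm ℝ) (I : Set ℝ) (z : ℝ) : ℝ :=
  (T ^ returnTime T I z) z

/-- The transformation induced by `T` on `[u,v)` is an interval exchange
transformation on `k` intervals with data `(lam, σ)`. -/
def InducedData (T : Equiv.Perm ℝ) (u v : ℝ) (k : ℕ) (lam : Fin k → ℝ)
    (σ : Equiv.Perm (Fin k)) : Prop :=
  ∃ S : Equiv.Perm ℝ, IsIET k u v lam σ S ∧
    ∀ z ∈ Set.Ico u v, S z = inducedMap T (Set.Ico u v) z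

/-- The semi-interval `[l,t)` is right admissible for `T`. -/
def RightAdmissible (s : ℕ) (l r : ℝ) (len : Fin s → ℝ) (T : Equiv.Perm ℝ)
    (t : ℝ) : Prop :=
  l < t ∧ t < r ∧ ∃ (i : Fin s) (k : ℤ), t = (T ^ k) (sepPt l len i) ∧
    (0 < k → ∀ h : ℤ, 0 < h → h < k → t < (T ^ h) (sepPt l len i)) ∧
    (k ≤ 0 → ∀ h : ℤ, k < h → h ≤ 0 → t < (T ^ h) (sepPt l len i))

/-- `ρ⁺_{I,T}(z) = min {n > 0 : T^n z ∈ (u,v)}`. -/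
def rhoPlusPt (T : Equiv.Perm ℝ) (u v z : ℝ) : ℕ :=
  sInf {n : ℕ | 0 < n ∧ (T ^ n) z ∈ Set.Ioo u v}

/-- `ρ⁻_{I,T}(z) = min {n ≥ 0 : T^{-n} z ∈ (u,v)}`. -/
def rhoMinusPt (T : Equiv.Perm ℝ) (u v z : ℝ) : ℕ :=
  sInf {n : ℕ | (T⁻¹ ^ n) z ∈ Set.Ioo u v}

/-- The set of neighbours `N_{I,T}(z)` of `z` with respect to `I = [u,v)` and `T`. -/
def neighbours (T : Equiv.Perm ℝ) (u v z : ℝ) : Set ℝ :=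
  {w | ∃ k : ℤ, -(rhoMinusPt T u v z : ℤ) ≤ k ∧ k < (rhoPlusPt T u v z : ℤ) ∧
    w = (T ^ k) z}

/-- The set of division points `Div(I,T)` of `I = [u,v)` with respect to `T`. -/
def divPoints (s : ℕ) (l : ℝ) (len : Fin s → ℝ) (T : Equiv.Perm ℝ)
    (u v : ℝ) : Set ℝ :=
  ⋃ i : Fin s, neighbours T u v (sepPt l len i)

/-- The semi-interval `[u,v) ⊆ [l,r)` is admissible for `T`. -/
def Admissible (s : ℕ) (l r : ℝ) (len : Fin s → ℝ) (T : Equiv.Perm ℝ)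
    (u v : ℝ) : Prop :=
  l ≤ u ∧ u < v ∧ v ≤ r ∧
  u ∈ divPoints s l len T u v ∪ {r} ∧ v ∈ divPoints s l len T u v ∪ {r}

/-- A bundled regular `s`-interval exchange transformation. -/
structure RIET (s : ℕ) where
  l : ℝ
  r : ℝ
  len : Fin s → ℝ
  perm : Equiv.Perm (Fin s)
  T : Equiv.Perm ℝ
  isIET : IsIET s l r len perm T
  isReg : IsRegularIET s l len T

/-- The right endpoint `max (γ_s, δ_{π(s)})` of `Z(T)`. -/
def zPoint {s : ℕ} (X : RIET s) : ℝ :=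
  if h : 0 < s then
    max (sepPt X.l X.len ⟨s - 1, by omega⟩)
      (imgPt X.l X.len X.perm (X.perm.symm ⟨s - 1, by omega⟩))
  else X.r

/-- The left endpoint `min (γ_2, δ_{π(2)})` of `Y(T)`. -/
def yPoint {s : ℕ} (X : RIET s) : ℝ :=
  if h : 1 < s then
    min (sepPt X.l X.len ⟨1, h⟩) (imgPt X.l X.len X.perm (X.perm.symm ⟨1, h⟩))
  else X.l

/-- `Y = ψ(X)`: one step of the right Rauzy induction. -/
def PsiStep {s : ℕ} (X Y : RIET s) : Prop :=
  Y.l = X.l ∧ Y.r = zPoint X ∧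
  ∀ z ∈ Set.Ico X.l (zPoint X), Y.T z = inducedMap X.T (Set.Ico X.l (zPoint X)) z

/-- `Y = φ(X)`: one step of the left Rauzy induction. -/
def PhiStep {s : ℕ} (X Y : RIET s) : Prop :=
  Y.l = yPoint X ∧ Y.r = X.r ∧
  ∀ z ∈ Set.Ico (yPoint X) X.r, Y.T z = inducedMap X.T (Set.Ico (yPoint X) X.r) z

/-- Equivalence of two `s`-interval exchange transformations: `(σ, mu)` is obtained
from `(π, lam)` by rescaling, possibly combined with the reversal `τ : i ↦ s - i + 1`. -/
def IETEquiv (s : ℕ) (π σ : Equiv.Perm (Fin s)) (lam mu : Fin s → ℝ) : Prop :=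
  (∃ c : ℝ, 0 < c ∧ σ = π ∧ ∀ i, mu i = c * lam i) ∨
  (∃ c : ℝ, 0 < c ∧ (∀ i, σ i = (π i).rev) ∧ ∀ i, mu i = c * lam i.rev)

/-- The subring `ℤ[√d]` of `ℝ`. -/
def Zsd (d : ℤ) : Set ℝ := {z | ∃ m n : ℤ, z = (m : ℝ) + (n : ℝ) * Real.sqrt d}

/-- `Ψ(z) = max (|m|,|n|)` for `z = m + n√d` (the representation being unique
when `d ≥ 2` is squarefree). -/
def PsiNum (d : ℤ) (z : ℝ) : ℕ :=
  sInf {k : ℕ | ∃ m n : ℤ, z = (m : ℝ) + (n : ℝ) * Real.sqrt d ∧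
    k = max m.natAbs n.natAbs}

/-- `Ψ(S) = max {Ψ(z) : z ∈ ∂S}`. -/
def PsiSet (d : ℤ) (S : Set ℝ) : ℕ := sSup (PsiNum d '' frontier S)

/-- The reduced complexity `Π(S) = |S| ⬝ Ψ(S)`. -/
def PiSet (d : ℤ) (S : Set ℝ) : ℝ := (volume S).toReal * PsiSet d S

/-- `S` belongs to the algebra `A([l,r))`: a nonempty finite union of semi-intervals
of `[l,r)` with endpoints in `ℤ[√d]`. -/
def MemA (d : ℤ) (l r : ℝ) (S : Set ℝ) : Prop :=
  S.Nonempty ∧ S ⊆ Set.Ico l r ∧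
  ∃ (k : ℕ) (a b : Fin k → ℝ), (∀ j, a j ∈ Zsd d ∧ b j ∈ Zsd d ∧ a j < b j) ∧
    S = ⋃ j, Set.Ico (a j) (b j)

/-- The interval exchange transformation with data `(l, r, len, π)` is defined over
`ℤ[√d]`: `l`, `r`, the separation points and the translation values lie in `ℤ[√d]`. -/
def DefinedOverZ (d : ℤ) (s : ℕ) (l r : ℝ) (len : Fin s → ℝ)
    (π : Equiv.Perm (Fin s)) : Prop :=
  l ∈ Zsd d ∧ r ∈ Zsd d ∧
  ∀ i, sepPt l len i ∈ Zsd d ∧ (imgPt l len π i - sepPt l len i) ∈ Zsd d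

/-- Maximal positive return time `ρ⁺(S)`. -/
def rhoPlusSet (T : Equiv.Perm ℝ) (S : Set ℝ) : ℕ :=
  sInf {n : ℕ | 1 ≤ n ∧ ⇑(T ^ n) '' S ⊆ ⋃ i ∈ Finset.range n, ⇑(T ^ i) '' S}

/-- Maximal negative return time `ρ⁻(S)`. -/
def rhoMinusSet (T : Equiv.Perm ℝ) (S : Set ℝ) : ℕ :=
  sInf {m : ℕ | 1 ≤ m ∧ ⇑(T ^ m) '' S ⊆ ⋃ i ∈ Finset.range m, ⇑(T⁻¹ ^ i) '' S}

/-- Minimal positive return time `σ⁺(S)`. -/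
def sigmaPlusSet (T : Equiv.Perm ℝ) (S : Set ℝ) : ℕ :=
  sInf {n : ℕ | 1 ≤ n ∧ (⇑(T ^ n) '' S ∩ S).Nonempty}

/-- Minimal negative return time `σ⁻(S)`. -/
def sigmaMinusSet (T : Equiv.Perm ℝ) (S : Set ℝ) : ℕ :=
  sInf {m : ℕ | 1 ≤ m ∧ (⇑(T⁻¹ ^ m) '' S ∩ S).Nonempty}

/-- `D_{m,n}(T) = ⋃_{i=-m+1}^{n} T^i (Sep(T))`. -/
def Dmn (s : ℕ) (l : ℝ) (len : Fin s → ℝ) (T : Equiv.Perm ℝ) (m n : ℕ) : Set ℝ :=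
  {w | ∃ (i : Fin s) (k : ℤ), -(m : ℤ) + 1 ≤ k ∧ k ≤ (n : ℤ) ∧
    w = (T ^ k) (sepPt l len i)}

/-- `[u,v)` belongs to `U(T) = ⋃_{m,n ≥ 1} U_{m,n}(T)`: it is one of the
semi-intervals into which `D_{m,n}(T)` partitions `[l,r)`. -/
def MemU (s : ℕ) (l r : ℝ) (len : Fin s → ℝ) (T : Equiv.Perm ℝ) (u v : ℝ) : Prop :=
  ∃ m n : ℕ, 1 ≤ m ∧ 1 ≤ n ∧ u ∈ Dmn s l len T m n ∧
    (v ∈ Dmn s l len T m n ∨ v = r) ∧ ∀ w ∈ Dmn s l len T m n, w ∉ Set.Ioo u v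

/-- `f` preserves `[l,r)` and is a translation on each interval of `[l,r)` that is cut out
by the finite set `C`. -/
structure IsPiecewiseTranslation (f : Equiv.Perm ℝ) (l r : ℝ) (C : Set ℝ) : Prop where
  finite : C.Finite
  mem_iff : ∀ z, f z ∈ Set.Ico l r ↔ z ∈ Set.Ico l r
  translate : ∀ x y, l ≤ x → x < y → y < r → (∀ c ∈ C, c ∉ Set.Ioc x y) → f y - y = f x - x

/-- The points of `[l,t)` through which a backward orbit starting in `D` enters `[l,t)` for the
first time. -/
def entryPts (f : Equiv.Perm ℝ) (D : Set ℝ) (l t : ℝ) : Set ℝ :=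
  {w | w ∈ Set.Ico l t ∧
    ∃ h : ℕ, (f ^ h) w ∈ D ∧ ∀ g : ℕ, 0 < g → g ≤ h → (f ^ g) w ∉ Set.Ico l t}

theorem perm_apply_inv (f : Equiv.Perm ℝ) (x : ℝ) : f (f⁻¹ x) = x := f.apply_symm_apply x

theorem pow_apply_eq_pow_sub_apply {f : Equiv.Perm ℝ} {a b : ℕ} {x y : ℝ} (hab : a ≤ b)
    (h : (f ^ a) x = (f ^ b) y) : x = (f ^ (b - a)) y := by
  apply (f ^ a).injective
  rw [h, ← Equiv.Perm.mul_apply, ← pow_add, Nat.add_sub_cancel' hab]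

theorem entry_unique {f : Equiv.Perm ℝ} {I : Set ℝ} {x y : ℝ} {a b : ℕ} (hx : x ∈ I) (hy : y ∈ I)
    (hxa : ∀ g : ℕ, 0 < g → g ≤ a → (f ^ g) x ∉ I)
    (hyb : ∀ g : ℕ, 0 < g → g ≤ b → (f ^ g) y ∉ I) (h : (f ^ a) x = (f ^ b) y) : x = y := by
  rcases le_total a b with hab | hab
  · have e := pow_apply_eq_pow_sub_apply hab h
    rcases Nat.eq_zero_or_pos (b - a) with h0 | h0
    · simpa [h0] using e
    · exact absurd (e ▸ hx) (hyb _ h0 (Nat.sub_le _ _))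
  · have e := pow_apply_eq_pow_sub_apply hab h.symm
    rcases Nat.eq_zero_or_pos (a - b) with h0 | h0
    · simpa [h0] using e.symm
    · exact absurd (e ▸ hy) (hxa _ h0 (Nat.sub_le _ _))

theorem entryPts_finite {f : Equiv.Perm ℝ} {D : Set ℝ} (hD : D.Finite) (l t : ℝ) :
    (entryPts f D l t).Finite := by
  have hsub : entryPts f D l t ⊆ ⋃ c ∈ D, {w | w ∈ Set.Ico l t ∧
      ∃ h : ℕ, (f ^ h) w = c ∧ ∀ g : ℕ, 0 < g → g ≤ h → (f ^ g) w ∉ Set.Ico l t} := by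
    rintro w ⟨hw, h, hD, hg⟩
    exact Set.mem_biUnion hD ⟨hw, h, rfl, hg⟩
  refine (hD.biUnion fun c _ => ?_).subset hsub
  apply Set.Subsingleton.finite
  rintro x ⟨hx, a, hxa, ha⟩ y ⟨hy, b, hyb, hb⟩
  exact entry_unique hx hy ha hb (hxa.trans hyb.symm)

namespace IsPiecewiseTranslation

variable {f : Equiv.Perm ℝ} {l r t : ℝ} {C : Set ℝ}

theorem mapsTo (hf : IsPiecewiseTranslation f l r C) (z : ℝ) (hz : z ∈ Set.Ico l r) :
    f z ∈ Set.Ico l r := (hf.mem_iff z).2 hz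

theorem pow_mem (hf : IsPiecewiseTranslation f l r C) {z : ℝ} (hz : z ∈ Set.Ico l r) (n : ℕ) :
    (f ^ n) z ∈ Set.Ico l r := by
  induction n with
  | zero => simpa using hz
  | succ n ih => rw [pow_succ', Equiv.Perm.mul_apply]; exact hf.mapsTo _ ih

/-- Up to and including the first return of `x` to `[l,t)`, the points of an interval `[x,y]`
that contains no entry point except possibly `x` move along with `x`. -/
theorem shadow (hf : IsPiecewiseTranslation f l r C) (htr : t ≤ r) {x y : ℝ}
    (hx : l ≤ x) (hy : y < t) (hE : ∀ w ∈ entryPts f (insert t C) l t, w ∉ Set.Ioc x y) (h : ℕ) :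
    (∀ g : ℕ, 0 < g → g < h → (f ^ g) x ∉ Set.Ico l t) → ∀ w ∈ Set.Icc x y,
      (f ^ h) w = (f ^ h) x + (w - x) ∧
      (0 < h → ((f ^ h) w ∈ Set.Ico l t ↔ (f ^ h) x ∈ Set.Ico l t)) := by
  induction h using Nat.strong_induction_on with
  | _ h ih =>
    rcases h with _ | h
    · intro _ w hw; simp
    intro hret
    have hprev : ∀ w ∈ Set.Icc x y, ∀ g : ℕ, 0 < g → g ≤ h → (f ^ g) w ∉ Set.Ico l t := by
      intro w hw g hg hgh hmem
      have := (ih g (by omega) (fun g' h1 h2 => hret g' h1 (by omega)) w hw).2 hg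
      exact hret g hg (by omega) (this.1 hmem)
    have htransh : ∀ w ∈ Set.Icc x y, (f ^ h) w = (f ^ h) x + (w - x) := fun w hw =>
      (ih h (by omega) (fun g' h1 h2 => hret g' h1 (by omega)) w hw).1
    have hmem : ∀ w ∈ Set.Icc x y, ∀ n : ℕ, (f ^ n) w ∈ Set.Ico l r := fun w hw n =>
      hf.pow_mem ⟨hx.trans hw.1, hw.2.trans_lt (hy.trans_le htr)⟩ n
    have hstep : ∀ w ∈ Set.Icc x y, (f ^ (h + 1)) w = (f ^ (h + 1)) x + (w - x) := by
      intro w hw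
      rcases hw.1.eq_or_lt with rfl | hxw
      · simp
      have hxI : x ∈ Set.Icc x y := ⟨le_rfl, hw.1.trans hw.2⟩
      have key := hf.translate ((f ^ h) x) ((f ^ h) w) (hmem x hxI h).1
        (by rw [htransh w hw]; linarith) (hmem w hw h).2 (by
          intro c hc hcI
          rw [htransh w hw] at hcI
          have hv : x + (c - (f ^ h) x) ∈ Set.Ioc x y :=
            ⟨by linarith [hcI.1], by linarith [hcI.2, hw.2]⟩
          have hv' := Set.Ioc_subset_Icc_self hv
          refine hE _ ⟨⟨hx.trans hv.1.le, hv.2.trans_lt hy⟩, h, ?_, hprev _ hv'⟩ hv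
          rw [htransh _ hv']
          right; convert hc using 1; ring)
      rw [pow_succ', Equiv.Perm.mul_apply, Equiv.Perm.mul_apply]
      have := htransh w hw
      linarith
    intro w hw
    refine ⟨hstep w hw, fun _ => ?_⟩
    have hxI : x ∈ Set.Icc x y := ⟨le_rfl, hw.1.trans hw.2⟩
    have e := hstep w hw
    refine ⟨fun hwI => ⟨(hmem x hxI _).1, by linarith [hwI.2, hw.1]⟩,
      fun hxI' => ⟨(hmem w hw _).1, ?_⟩⟩
    by_contra hcon
    push Not at hcon
    have hv : x + (t - (f ^ (h + 1)) x) ∈ Set.Ioc x y :=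
      ⟨by linarith [hxI'.2], by linarith [hw.2]⟩
    have hv' := Set.Ioc_subset_Icc_self hv
    have hvt : (f ^ (h + 1)) (x + (t - (f ^ (h + 1)) x)) = t := by rw [hstep _ hv']; ring
    refine hE _ ⟨⟨hx.trans hv.1.le, hv.2.trans_lt hy⟩, h + 1, Or.inl hvt, ?_⟩ hv
    intro g hg hgh
    rcases Nat.lt_or_eq_of_le hgh with hlt | rfl
    · exact hprev _ hv' g hg (by omega)
    · rw [hvt]; exact fun hh => lt_irrefl _ hh.2

theorem exists_return (hf : IsPiecewiseTranslation f l r C) (htr : t ≤ r) {x : ℝ}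
    (hx : x ∈ Set.Ico l t) : ∃ n : ℕ, 0 < n ∧ (f ^ n) x ∈ Set.Ico l t := by
  obtain ⟨y, hxy, hyt, hE⟩ : ∃ y, x < y ∧ y < t ∧
      ∀ w ∈ entryPts f (insert t C) l t, w ∉ Set.Ioc x y := by
    have hfin : (entryPts f (insert t C) l t \ {x}).Finite :=
      (entryPts_finite (hf.finite.insert t) l t).subset Set.sdiff_subset
    have hn : (entryPts f (insert t C) l t \ {x})ᶜ ∈ nhds x :=
      hfin.isClosed.isOpen_compl.mem_nhds (by simp)
    obtain ⟨ε, hε, hball⟩ := Metric.mem_nhds_iff.1 hn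
    refine ⟨min (x + ε / 2) ((x + t) / 2), lt_min (by linarith) (by linarith [hx.2]),
      (min_le_right _ _).trans_lt (by linarith [hx.2]), fun w hw hwI => ?_⟩
    have h1 := hwI.2.trans (min_le_left _ _)
    exact hball (show w ∈ Metric.ball x ε by
      rw [Metric.mem_ball, Real.dist_eq, abs_of_pos (by linarith [hwI.1])]; linarith)
      ⟨hw, hwI.1.ne'⟩
  by_contra hno
  push Not at hno
  have hsh := fun h => hf.shadow htr hx.1 hyt hE h (fun g hg _ => hno g hg)
  have hnoW : ∀ w ∈ Set.Icc x y, ∀ n : ℕ, 0 < n → (f ^ n) w ∉ Set.Ico l t := fun w hw n hn hh =>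
    hno n hn (((hsh n w hw).2 hn).1 hh)
  have hd : 0 < y - x := sub_pos.2 hxy
  have hbd := fun n => hf.pow_mem (⟨hx.1, hx.2.trans_le htr⟩ : x ∈ Set.Ico l r) n
  have hmaps : Set.MapsTo (fun n : ℕ => ⌊((f ^ n) x - l) / (y - x)⌋) Set.univ
      (Set.Icc 0 ⌊(r - l) / (y - x)⌋) := by
    intro n _
    refine ⟨Int.floor_nonneg.2 (div_nonneg (by linarith [(hbd n).1]) hd.le), ?_⟩
    apply Int.floor_le_floor
    gcongr
    exact (hbd n).2.le
  obtain ⟨a, -, b, -, hab, hfl⟩ := Set.infinite_univ.exists_lt_map_eq_of_mapsTo hmaps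
    (Set.finite_Icc _ _)
  have habs := Int.abs_sub_lt_one_of_floor_eq_floor hfl
  rw [← sub_div, abs_div, abs_of_pos hd, div_lt_one hd, abs_lt] at habs
  rcases le_total ((f ^ a) x) ((f ^ b) x) with hle | hle
  · have hw : x + ((f ^ b) x - (f ^ a) x) ∈ Set.Icc x y := ⟨by linarith, by linarith⟩
    have e := (hsh a _ hw).1
    have := pow_apply_eq_pow_sub_apply hab.le (show _ = (f ^ b) x by rw [e]; ring)
    exact hno (b - a) (by omega) (by rw [← this]; exact ⟨hx.1.trans hw.1, hw.2.trans_lt hyt⟩)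
  · have hw : x + ((f ^ a) x - (f ^ b) x) ∈ Set.Icc x y := ⟨by linarith, by linarith⟩
    have e := (hsh b _ hw).1
    have := pow_apply_eq_pow_sub_apply hab.le
      (show (f ^ a) x = (f ^ b) (x + ((f ^ a) x - (f ^ b) x)) by rw [e]; ring)
    exact hnoW _ hw (b - a) (by omega) (this ▸ hx)

theorem returnTime_spec (hf : IsPiecewiseTranslation f l r C) (htr : t ≤ r) {x : ℝ}
    (hx : x ∈ Set.Ico l t) :
    0 < returnTime f (Set.Ico l t) x ∧ inducedMap f (Set.Ico l t) x ∈ Set.Ico l t :=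
  Nat.sInf_mem (hf.exists_return htr hx)

end IsPiecewiseTranslation

theorem pow_notMem_of_lt_returnTime {f : Equiv.Perm ℝ} {I : Set ℝ} {x : ℝ} {g : ℕ} (hg : 0 < g)
    (h : g < returnTime f I x) : (f ^ g) x ∉ I := fun hmem => Nat.notMem_of_lt_sInf h ⟨hg, hmem⟩

theorem returnTime_eq {f : Equiv.Perm ℝ} {I : Set ℝ} {x : ℝ} {n : ℕ} (hn : 0 < n)
    (hmem : (f ^ n) x ∈ I) (hlt : ∀ g : ℕ, 0 < g → g < n → (f ^ g) x ∉ I) :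
    returnTime f I x = n := by
  have hmem' : n ∈ {n : ℕ | 0 < n ∧ (f ^ n) x ∈ I} := ⟨hn, hmem⟩
  refine le_antisymm (Nat.sInf_le hmem') (le_csInf ⟨n, hmem'⟩ fun m hm => ?_)
  by_contra hcon
  exact hlt m hm.1 (by omega) hm.2

namespace IsPiecewiseTranslation

variable {f : Equiv.Perm ℝ} {l r t : ℝ} {C : Set ℝ}

theorem returnTime_eq_and_inducedMap (hf : IsPiecewiseTranslation f l r C) (htr : t ≤ r) {x y : ℝ}
    (hx : l ≤ x) (hxy : x ≤ y) (hy : y < t)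
    (hE : ∀ w ∈ entryPts f (insert t C) l t, w ∉ Set.Ioc x y) :
    returnTime f (Set.Ico l t) y = returnTime f (Set.Ico l t) x ∧
      inducedMap f (Set.Ico l t) y - y = inducedMap f (Set.Ico l t) x - x := by
  have hyI : y ∈ Set.Icc x y := ⟨hxy, le_rfl⟩
  obtain ⟨hpos, hmem⟩ := hf.returnTime_spec htr (⟨hx, hxy.trans_lt hy⟩ : x ∈ Set.Ico l t)
  set n := returnTime f (Set.Ico l t) x with hn
  have hsh := fun h (hh : h ≤ n) => hf.shadow htr hx hy hE h
    (fun g hg hgh => pow_notMem_of_lt_returnTime hg (by omega)) y hyI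
  have heq : returnTime f (Set.Ico l t) y = n := by
    refine returnTime_eq hpos (((hsh n le_rfl).2 hpos).2 hmem) fun g hg hgn hh => ?_
    exact pow_notMem_of_lt_returnTime hg hgn (((hsh g hgn.le).2 hg).1 hh)
  refine ⟨heq, ?_⟩
  unfold inducedMap
  rw [heq, ← hn, (hsh n le_rfl).1]
  ring

theorem returnTime_bounded (hf : IsPiecewiseTranslation f l r C) (htr : t ≤ r) :
    ∃ N : ℕ, ∀ x ∈ Set.Ico l t, returnTime f (Set.Ico l t) x ≤ N := by
  have hfin : (insert l (entryPts f (insert t C) l t)).Finite :=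
    (entryPts_finite (hf.finite.insert t) l t).insert l
  obtain ⟨N, hN⟩ := (hfin.image (returnTime f (Set.Ico l t))).bddAbove
  refine ⟨N, fun x hx => ?_⟩
  obtain ⟨b, ⟨hb, hbx⟩, hmax⟩ := (hfin.inter_of_left {b | b ≤ x}).exists_maximal
    ⟨l, Set.mem_insert _ _, hx.1⟩
  have hlb : l ≤ b := by
    rcases hb with rfl | hb
    · exact le_rfl
    · exact hb.1.1
  rw [(hf.returnTime_eq_and_inducedMap htr hlb hbx hx.2 (fun w hw hwI =>
    hwI.1.not_ge (hmax ⟨Or.inr hw, hwI.2⟩ hwI.1.le))).1]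
  exact hN ⟨b, hb, rfl⟩

theorem eventually_eq_add (hf : IsPiecewiseTranslation f l r C) {x : ℝ} (hx : x ∈ Set.Ioo l r)
    (hxC : x ∉ C) : ∀ᶠ z in nhds x, f z = z + (f x - x) := by
  have h1 : Cᶜ ∈ nhds x := hf.finite.isClosed.isOpen_compl.mem_nhds hxC
  have h2 : Set.Ioo l r ∈ nhds x := isOpen_Ioo.mem_nhds hx
  obtain ⟨ε, hε, hball⟩ := Metric.mem_nhds_iff.1 (Filter.inter_mem h1 h2)
  filter_upwards [Metric.ball_mem_nhds x hε] with z hz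
  have hzr := (hball hz).2
  rw [Real.ball_eq_Ioo] at hz hball
  rcases lt_trichotomy x z with hlt | rfl | hlt
  · have := hf.translate x z hx.1.le hlt hzr.2 fun c hc hcI =>
      (hball ⟨by linarith [hcI.1], by linarith [hcI.2, hz.2]⟩).1 hc
    linarith
  · ring
  · have := hf.translate z x hzr.1.le hlt hx.2 fun c hc hcI =>
      (hball ⟨by linarith [hcI.1, hz.1], by linarith [hcI.2]⟩).1 hc
    linarith

theorem frontier_iff (hf : IsPiecewiseTranslation f l r C) {x : ℝ} (hx : x ∈ Set.Ioo l r)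
    (hxC : x ∉ C) {A A' : Set ℝ} (hA : ∀ z, f z ∈ A' ↔ z ∈ A) :
    f x ∈ frontier A' ↔ x ∈ frontier A := by
  have hev := hf.eventually_eq_add hx hxC
  have hmap : nhds (f x) = Filter.map (fun z => z + (f x - x)) (nhds x) := by
    rw [map_add_right_nhds]; congr 1; ring
  have key : ∀ B B' : Set ℝ, (∀ z, f z ∈ B' ↔ z ∈ B) → (f x ∈ closure B' ↔ x ∈ closure B) := by
    intro B B' hB
    rw [mem_closure_iff_frequently, mem_closure_iff_frequently, hmap, Filter.frequently_map]
    refine Filter.frequently_congr ?_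
    filter_upwards [hev] with z hz
    rw [← hz, hB]
  rw [frontier_eq_closure_inter_closure, frontier_eq_closure_inter_closure, Set.mem_inter_iff,
    Set.mem_inter_iff, key A A' hA, key Aᶜ A'ᶜ (fun z => not_congr (hA z))]

theorem map_mem_Ioo (hf : IsPiecewiseTranslation f l r C) {x : ℝ} (hx : x ∈ Set.Ioo l r)
    (hxC : x ∉ C) : f x ∈ Set.Ioo l r := by
  have h := hf.mapsTo x ⟨hx.1.le, hx.2⟩
  refine ⟨lt_of_le_of_ne h.1 fun heq => ?_, h.2⟩
  have hev := hf.eventually_eq_add hx hxC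
  have h2 : Set.Ioo l r ∈ nhds x := isOpen_Ioo.mem_nhds hx
  obtain ⟨ε, hε, hball⟩ := Metric.mem_nhds_iff.1 (Filter.inter_mem hev h2)
  have hz := hball (show x - ε / 2 ∈ Metric.ball x ε by
    rw [Real.ball_eq_Ioo]; constructor <;> linarith)
  have hz1 : f (x - ε / 2) = x - ε / 2 + (f x - x) := hz.1
  have := (hf.mapsTo _ ⟨hz.2.1.le, hz.2.2⟩).1
  linarith

end IsPiecewiseTranslation

namespace IsPiecewiseTranslation

variable {f : Equiv.Perm ℝ} {l r t : ℝ} {C C' : Set ℝ}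

theorem frontier_image_finite (hf : IsPiecewiseTranslation f l r C) {A : Set ℝ}
    (hA : A ⊆ Set.Ico l r) (hfin : (frontier A).Finite) : (frontier (f '' A)).Finite := by
  refine (((Set.finite_singleton r).insert l).union
    ((hfin.union (hf.finite.insert l)).image f)).subset fun a ha => ?_
  have haI : a ∈ Set.Icc l r := by
    have h1 : f '' A ⊆ Set.Icc l r := by
      rintro _ ⟨z, hz, rfl⟩
      exact Set.Ico_subset_Icc_self (hf.mapsTo z (hA hz))
    exact closure_minimal h1 isClosed_Icc (frontier_subset_closure ha)
  by_cases har : a = r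
  · exact Or.inl (Or.inr har)
  right
  obtain ⟨x, rfl⟩ := f.surjective a
  have hxI := (hf.mem_iff x).1 ⟨haI.1, lt_of_le_of_ne haI.2 har⟩
  refine ⟨x, ?_, rfl⟩
  by_cases hxl : x = l
  · exact Or.inr (Or.inl hxl)
  by_cases hxC : x ∈ C
  · exact Or.inr (Or.inr hxC)
  left
  exact (hf.frontier_iff ⟨lt_of_le_of_ne hxI.1 (Ne.symm hxl), hxI.2⟩ hxC
    (fun z => f.injective.mem_set_image)).1 ha

theorem frontier_pow_image_finite (hf : IsPiecewiseTranslation f l r C) (htr : t ≤ r) (n : ℕ) :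
    (frontier ((f ^ n) '' Set.Ico l t)).Finite := by
  induction n with
  | zero =>
    rcases lt_or_ge l t with h | h
    · simp [frontier_Ico h]
    · simp [Set.Ico_eq_empty h.not_gt]
  | succ n ih =>
    rw [pow_succ', Equiv.Perm.coe_mul, Set.image_comp]
    refine hf.frontier_image_finite ?_ ih
    rintro _ ⟨x, hx, rfl⟩
    exact hf.pow_mem ⟨hx.1, hx.2.trans_le htr⟩ n

/-- If no point is periodic and there are no connections between break points, then every
point is reached from `[l,t)` by forward iteration. -/
theorem exists_pow_eq (hf : IsPiecewiseTranslation f l r C)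
    (hf' : IsPiecewiseTranslation f⁻¹ l r C')
    (hper : ∀ z ∈ Set.Ico l r, ∀ n : ℕ, 0 < n → (f ^ n) z ≠ z)
    (hconn : ∀ b ∈ insert l C, ∀ c ∈ C, ∀ n : ℕ, 0 < n → (f ^ n) b ≠ c)
    (hlt : l < t) (htr : t ≤ r) {z : ℝ} (hz : z ∈ Set.Ico l r) :
    ∃ n : ℕ, ∃ x ∈ Set.Ico l t, (f ^ n) x = z := by
  set U : Set ℝ := {z | ∃ n : ℕ, ∃ x ∈ Set.Ico l t, (f ^ n) x = z} with hU
  have hIU : Set.Ico l t ⊆ U := fun x hx => ⟨0, x, hx, rfl⟩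
  have hinv : ∀ z, f z ∈ U ↔ z ∈ U := by
    intro z
    constructor
    · rintro ⟨n, x, hx, hn⟩
      rcases n with _ | n
      · obtain ⟨m, hm, hmem⟩ := hf'.exists_return htr hx
        obtain ⟨m, rfl⟩ := Nat.exists_eq_succ_of_ne_zero hm.ne'
        refine ⟨m, _, hmem, f.injective ?_⟩
        rw [← Equiv.Perm.mul_apply, ← pow_succ', inv_pow, perm_apply_inv, ← hn, pow_zero,
          Equiv.Perm.one_apply]
      · exact ⟨n, x, hx, f.injective (by rw [← hn, pow_succ', Equiv.Perm.mul_apply])⟩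
    · rintro ⟨n, x, hx, rfl⟩
      exact ⟨n + 1, x, hx, by rw [pow_succ', Equiv.Perm.mul_apply]⟩
  obtain ⟨N, hN⟩ := hf.returnTime_bounded htr
  have hUeq : U ⊆ ⋃ k ∈ Finset.range (N + 1), (f ^ k) '' Set.Ico l t := by
    rintro _ ⟨n, x, hx, rfl⟩
    induction n using Nat.strong_induction_on generalizing x with
    | _ n ih =>
      by_cases hn : n < N + 1
      · simp only [Set.mem_iUnion]
        exact ⟨n, Finset.mem_range.2 hn, x, hx, rfl⟩
      · obtain ⟨hpos, hmem⟩ := hf.returnTime_spec htr hx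
        have := ih (n - returnTime f (Set.Ico l t) x) (by have := hN x hx; omega) _ hmem
        rw [inducedMap, ← Equiv.Perm.mul_apply, ← pow_add,
          Nat.sub_add_cancel (by have := hN x hx; omega)] at this
        exact this
  have hUeq' : U = ⋃ k ∈ Finset.range (N + 1), (f ^ k) '' Set.Ico l t := by
    refine hUeq.antisymm (Set.iUnion₂_subset fun k _ => ?_)
    rintro _ ⟨x, hx, rfl⟩
    exact ⟨k, x, hx, rfl⟩
  have hfin : (frontier U).Finite := by
    rw [hUeq']
    clear_value U
    generalize N + 1 = M
    induction M with
    | zero => simp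
    | succ M ih =>
      rw [Finset.range_add_one, Finset.set_biUnion_insert]
      exact ((hf.frontier_pow_image_finite htr M).union ih).subset
        ((frontier_union_subset _ _).trans
          (Set.union_subset_union Set.inter_subset_left Set.inter_subset_right))
  have hempty : ∀ a ∈ Set.Ioo l r, a ∉ frontier U := by
    intro a haI haF
    have hfin' : (Set.Ioo l r ∩ frontier U).Finite := hfin.subset Set.inter_subset_right
    obtain ⟨m, hm⟩ : ∃ m : ℕ, (f ^ m) a ∈ C := by
      by_contra hno
      push Not at hno
      have hall : ∀ m : ℕ, (f ^ m) a ∈ Set.Ioo l r ∩ frontier U := by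
        intro m
        induction m with
        | zero => exact ⟨haI, haF⟩
        | succ m ih =>
          rw [pow_succ', Equiv.Perm.mul_apply]
          exact ⟨hf.map_mem_Ioo ih.1 (hno m), (hf.frontier_iff ih.1 (hno m) hinv).2 ih.2⟩
      obtain ⟨i, -, j, -, hij, he⟩ := Set.infinite_univ.exists_lt_map_eq_of_mapsTo
        (f := fun m : ℕ => (f ^ m) a) (fun m _ => hall m) hfin'
      exact hper a ⟨haI.1.le, haI.2⟩ (j - i) (by omega)
        (pow_apply_eq_pow_sub_apply hij.le he).symm
    obtain ⟨n, hn⟩ : ∃ n : ℕ, (f⁻¹ ^ (n + 1)) a ∈ insert l C := by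
      by_contra hno
      push Not at hno
      have hall : ∀ m : ℕ, (f⁻¹ ^ m) a ∈ Set.Ioo l r ∩ frontier U := by
        intro m
        induction m with
        | zero => exact ⟨haI, haF⟩
        | succ m ih =>
          have hx := hno m
          have hmem := hf'.pow_mem (⟨haI.1.le, haI.2⟩ : a ∈ Set.Ico l r) (m + 1)
          have hfx : f ((f⁻¹ ^ (m + 1)) a) = (f⁻¹ ^ m) a := by
            rw [pow_succ', Equiv.Perm.mul_apply, perm_apply_inv]
          have hI : (f⁻¹ ^ (m + 1)) a ∈ Set.Ioo l r :=
            ⟨lt_of_le_of_ne hmem.1 fun h => hx (Or.inl h.symm), hmem.2⟩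
          refine ⟨hI, (hf.frontier_iff hI (fun h => hx (Or.inr h)) hinv).1 ?_⟩
          rw [hfx]
          exact ih.2
      obtain ⟨i, -, j, -, hij, he⟩ := Set.infinite_univ.exists_lt_map_eq_of_mapsTo
        (f := fun m : ℕ => (f⁻¹ ^ m) a) (fun m _ => hall m) hfin'
      refine hper a ⟨haI.1.le, haI.2⟩ (j - i) (by omega) ?_
      have := pow_apply_eq_pow_sub_apply hij.le he
      rw [inv_pow] at this
      exact (Equiv.Perm.eq_inv_iff_eq.1 this)
    refine hconn _ hn _ hm (m + (n + 1)) (by omega) ?_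
    rw [pow_add, Equiv.Perm.mul_apply, inv_pow, perm_apply_inv]
  rcases hz.1.eq_or_lt with rfl | hlz
  · exact hIU ⟨le_rfl, hlt⟩
  by_contra hzU
  have hcover : Set.Ioo l r ⊆ interior U ∪ interior Uᶜ := by
    intro a ha
    by_contra hcon
    rw [interior_compl, Set.mem_union, not_or, Set.mem_compl_iff, not_not] at hcon
    exact hempty a ha ⟨hcon.2, hcon.1⟩
  have hmid : (l + t) / 2 ∈ Set.Ioo l r := ⟨by linarith, by linarith⟩
  have hmidU : (l + t) / 2 ∈ U := hIU ⟨by linarith, by linarith⟩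
  obtain ⟨a, -, ha, ha'⟩ := isPreconnected_Ioo _ _ isOpen_interior isOpen_interior hcover
    ⟨_, hmid, (hcover hmid).resolve_right fun h => interior_subset h hmidU⟩
    ⟨z, ⟨hlz, hz.2⟩, (hcover ⟨hlz, hz.2⟩).resolve_left fun h =>
      hzU (show z ∈ U from interior_subset h)⟩
  exact interior_subset ha' (interior_subset ha)

end IsPiecewiseTranslation

theorem sepPt_add_le {s : ℕ} {l : ℝ} {len : Fin s → ℝ} (hlen : ∀ i, 0 < len i) {i j : Fin s}
    (hij : i < j) : sepPt l len i + len i ≤ sepPt l len j := by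
  have h : ∑ k ∈ insert i (Finset.univ.filter (fun k => k < i)), len k ≤
      ∑ k ∈ Finset.univ.filter (fun k => k < j), len k := by
    refine Finset.sum_le_sum_of_subset_of_nonneg ?_ fun k _ _ => (hlen k).le
    intro k hk
    rw [Finset.mem_insert, Finset.mem_filter] at hk
    rw [Finset.mem_filter]
    refine ⟨Finset.mem_univ _, ?_⟩
    rcases hk with rfl | hk
    · exact hij
    · exact hk.2.trans hij
  rw [Finset.sum_insert (by simp)] at h
  unfold sepPt
  linarith

theorem sepPt_of_eq_zero {s : ℕ} (l : ℝ) (len : Fin s → ℝ) {i : Fin s} (hi : (i : ℕ) = 0) :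
    sepPt l len i = l := by
  have : Finset.univ.filter (fun j : Fin s => j < i) = ∅ := by
    refine Finset.filter_eq_empty_iff.2 fun j _ => ?_
    rw [Fin.lt_def]
    omega
  simp [sepPt, this]

theorem lt_sepPt {s : ℕ} {l : ℝ} {len : Fin s → ℝ} (hlen : ∀ i, 0 < len i) {i : Fin s}
    (hi : (i : ℕ) ≠ 0) : l < sepPt l len i := by
  have h := sepPt_add_le (l := l) hlen (i := ⟨0, by omega⟩) (j := i) (Fin.lt_def.2 (by simp; omega))
  rw [sepPt_of_eq_zero l len rfl] at h
  linarith [hlen ⟨0, by omega⟩]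

theorem piece_unique {s : ℕ} {l : ℝ} {len : Fin s → ℝ} (hlen : ∀ i, 0 < len i) {i j : Fin s}
    {z : ℝ} (hi : z ∈ Set.Ico (sepPt l len i) (sepPt l len i + len i))
    (hj : z ∈ Set.Ico (sepPt l len j) (sepPt l len j + len j)) : i = j := by
  rcases lt_trichotomy i j with h | h | h
  · linarith [sepPt_add_le (l := l) hlen h, hi.2, hj.1]
  · exact h
  · linarith [sepPt_add_le (l := l) hlen h, hj.2, hi.1]

/-- The nonzero separation points. -/
def sepSet {s : ℕ} (l : ℝ) (len : Fin s → ℝ) : Set ℝ :=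
  {c | ∃ i : Fin s, (i : ℕ) ≠ 0 ∧ sepPt l len i = c}

namespace IsIET

variable {s : ℕ} {l r : ℝ} {len : Fin s → ℝ} {π : Equiv.Perm (Fin s)} {T : Equiv.Perm ℝ}

theorem exists_piece (hT : IsIET s l r len π T) {z : ℝ} (hz : z ∈ Set.Ico l r) :
    ∃ i, z ∈ Set.Ico (sepPt l len i) (sepPt l len i + len i) := by
  obtain ⟨-, hlen, hsum, -, -⟩ := hT
  have hs : 0 < s := by
    rcases Nat.eq_zero_or_pos s with rfl | h
    · simp at hsum; linarith [hz.1, hz.2]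
    · exact h
  obtain ⟨i, hi, hmax⟩ := (Finset.univ.filter (fun i => sepPt l len i ≤ z)).exists_max_image id
    ⟨⟨0, hs⟩, by simpa [sepPt_of_eq_zero l len (i := ⟨0, hs⟩) rfl] using hz.1⟩
  rw [Finset.mem_filter] at hi
  refine ⟨i, hi.2, ?_⟩
  by_contra hcon
  push Not at hcon
  have hins : sepPt l len i + len i =
      l + ∑ k ∈ insert i (Finset.univ.filter (fun k => k < i)), len k := by
    rw [Finset.sum_insert (by simp), sepPt]; ring
  by_cases h : (i : ℕ) + 1 < s
  · have : sepPt l len ⟨i + 1, h⟩ ≤ z := by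
      refine le_trans (le_of_eq ?_) hcon
      rw [hins, sepPt]
      congr 2
      ext k
      simp only [Finset.mem_filter, Finset.mem_univ, true_and, Finset.mem_insert, Fin.lt_def,
        Fin.ext_iff]
      omega
    have := hmax ⟨i + 1, h⟩ (by simpa using this)
    simp [Fin.le_def] at this
  · have : insert i (Finset.univ.filter (fun k => k < i)) = Finset.univ := by
      ext k
      simp only [Finset.mem_filter, Finset.mem_univ, true_and, Finset.mem_insert, Fin.lt_def,
        Fin.ext_iff, iff_true]
      omega
    rw [this, hsum] at hins
    linarith [hz.2]

theorem piece_subset (hT : IsIET s l r len π T) {i : Fin s} {z : ℝ}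
    (hz : z ∈ Set.Ico (sepPt l len i) (sepPt l len i + len i)) : z ∈ Set.Ico l r := by
  obtain ⟨-, hlen, hsum, -, -⟩ := hT
  have h1 : 0 ≤ ∑ k ∈ Finset.univ.filter (fun k => k < i), len k :=
    Finset.sum_nonneg fun k _ => (hlen k).le
  have h2 : ∑ k ∈ insert i (Finset.univ.filter (fun k => k < i)), len k ≤ ∑ k, len k :=
    Finset.sum_le_sum_of_subset_of_nonneg (Finset.subset_univ _) fun k _ _ => (hlen k).le
  rw [Finset.sum_insert (by simp), hsum] at h2
  unfold sepPt at hz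
  exact ⟨by linarith [hz.1], by linarith [hz.2]⟩

theorem sepPt_mem_piece (hT : IsIET s l r len π T) (i : Fin s) :
    sepPt l len i ∈ Set.Ico (sepPt l len i) (sepPt l len i + len i) :=
  ⟨le_rfl, by linarith [hT.2.1 i]⟩

theorem sepPt_mem (hT : IsIET s l r len π T) (i : Fin s) : sepPt l len i ∈ Set.Ico l r :=
  hT.piece_subset (hT.sepPt_mem_piece i)

theorem apply_piece (hT : IsIET s l r len π T) {i : Fin s} {z : ℝ}
    (hz : z ∈ Set.Ico (sepPt l len i) (sepPt l len i + len i)) :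
    T z = z + (T (sepPt l len i) - sepPt l len i) := by
  rw [hT.2.2.2.2 i z hz, hT.2.2.2.2 i _ (hT.sepPt_mem_piece i)]
  ring

theorem mem_iff (hT : IsIET s l r len π T) (z : ℝ) : T z ∈ Set.Ico l r ↔ z ∈ Set.Ico l r := by
  have hoff := hT.2.2.2.1
  constructor
  · intro h
    by_contra hz
    rw [hoff z hz] at h
    exact hz h
  · intro h
    by_contra hz
    rw [T.injective (hoff _ hz)] at hz
    exact hz h

theorem isPiecewiseTranslation (hT : IsIET s l r len π T) :
    IsPiecewiseTranslation T l r (sepSet l len) where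
  finite := (Set.finite_range (sepPt l len)).subset (by rintro c ⟨i, -, rfl⟩; exact ⟨i, rfl⟩)
  mem_iff := hT.mem_iff
  translate := by
    intro x y hx hxy hy hC
    obtain ⟨i, hi⟩ := hT.exists_piece (⟨hx, hxy.trans hy⟩ : x ∈ Set.Ico l r)
    obtain ⟨j, hj⟩ := hT.exists_piece (⟨hx.trans hxy.le, hy⟩ : y ∈ Set.Ico l r)
    obtain rfl : i = j := by
      rcases lt_trichotomy i j with h | h | h
      · have hj0 : (j : ℕ) ≠ 0 := by rw [Fin.lt_def] at h; omega
        refine absurd ⟨?_, hj.1⟩ (hC _ ⟨j, hj0, rfl⟩)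
        linarith [hi.2, sepPt_add_le (l := l) hT.2.1 h]
      · exact h
      · linarith [hj.2, hi.1, sepPt_add_le (l := l) hT.2.1 h]
    rw [hT.apply_piece hi, hT.apply_piece hj]
    ring

theorem isPiecewiseTranslation_inv (hT : IsIET s l r len π T) :
    IsPiecewiseTranslation T⁻¹ l r (Set.range fun i => T (sepPt l len i)) where
  finite := Set.finite_range _
  mem_iff z := by rw [← hT.mem_iff, perm_apply_inv]
  translate := by
    intro x y hx hxy hy hC
    have hpre : ∀ z ∈ Set.Ico l r, ∃ w, T w = z ∧
        ∃ i, w ∈ Set.Ico (sepPt l len i) (sepPt l len i + len i) := by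
      intro z hz
      refine ⟨T⁻¹ z, perm_apply_inv T z, hT.exists_piece ?_⟩
      rwa [← hT.mem_iff, perm_apply_inv]
    obtain ⟨a, rfl, i, hi⟩ := hpre x ⟨hx, hxy.trans hy⟩
    have hTa := hT.apply_piece hi
    have hinv : ∀ w, T⁻¹ (T w) = w := fun w => T.symm_apply_apply w
    by_cases hyi : y < T (sepPt l len i) + len i
    · have hb : sepPt l len i + (y - T (sepPt l len i)) ∈
          Set.Ico (sepPt l len i) (sepPt l len i + len i) :=
        ⟨by linarith [hi.1], by linarith⟩
      have hTb : T (sepPt l len i + (y - T (sepPt l len i))) = y := by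
        rw [hT.apply_piece hb]; ring
      rw [← hTb, hinv, hinv, hT.apply_piece hb]
      linarith
    · exfalso
      push Not at hyi
      have hai : T a < T (sepPt l len i) + len i := by linarith [hi.2]
      obtain ⟨c, hc, k, hk⟩ := hpre (T (sepPt l len i) + len i)
        ⟨by linarith, hyi.trans_lt hy⟩
      have hTc := hT.apply_piece hk
      by_cases hlt : T a < T (sepPt l len k)
      · exact hC _ ⟨k, rfl⟩ ⟨hlt, by linarith [hk.1]⟩
      · push Not at hlt
        have hd : sepPt l len k + (T a - T (sepPt l len k)) ∈
            Set.Ico (sepPt l len k) (sepPt l len k + len k) :=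
          ⟨by linarith, by linarith [hk.2]⟩
        have hTd : T (sepPt l len k + (T a - T (sepPt l len k))) = T a := by
          rw [hT.apply_piece hd]; ring
        rw [T.injective hTd] at hd
        obtain rfl := piece_unique hT.2.1 hd hi
        linarith [hk.2]

end IsIET

theorem orbitZ_finite {T : Equiv.Perm ℝ} {z : ℝ} {n : ℕ} (hn : 0 < n) (h : (T ^ n) z = z) :
    (orbitZ T z).Finite := by
  refine ((Finset.range n).finite_toSet.image fun m => (T ^ m) z).subset ?_
  rintro _ ⟨m, rfl⟩
  have hn' : (0 : ℤ) < n := by exact_mod_cast hn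
  refine ⟨(m % n).toNat, ?_, ?_⟩
  · have := Int.emod_lt_of_pos m hn'
    have := Int.emod_nonneg m hn'.ne'
    simp only [Finset.coe_range, Set.mem_Iio]
    omega
  · have h1 : ((T ^ n) ^ (m / n)) z = z :=
      Equiv.Perm.zpow_apply_eq_self_of_apply_eq_self h _
    have h2 : T ^ m = T ^ (m % n).toNat * (T ^ n) ^ (m / n) := by
      rw [← zpow_natCast, ← zpow_natCast T n, ← zpow_mul, ← zpow_add,
        Int.toNat_of_nonneg (Int.emod_nonneg m hn'.ne'), Int.emod_add_mul_ediv]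
    rw [h2, Equiv.Perm.mul_apply, h1]

namespace IsRegularIET

variable {s : ℕ} {l r : ℝ} {len : Fin s → ℝ} {π : Equiv.Perm (Fin s)} {T : Equiv.Perm ℝ}

theorem pow_sepPt_ne (hreg : IsRegularIET s l len T) {i : Fin s} (hi : (i : ℕ) ≠ 0) {n : ℕ}
    (hn : 0 < n) : (T ^ n) (sepPt l len i) ≠ sepPt l len i := fun h =>
  hreg.1 i hi (orbitZ_finite hn h)

theorem eq_of_mem_orbitZ (hreg : IsRegularIET s l len T) {i j : Fin s} (hi : (i : ℕ) ≠ 0)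
    (hj : (j : ℕ) ≠ 0) {z : ℝ} (hzi : z ∈ orbitZ T (sepPt l len i))
    (hzj : z ∈ orbitZ T (sepPt l len j)) : i = j := by
  by_contra hij
  exact Set.disjoint_left.1 (hreg.2 i j hi hj hij) hzi hzj

theorem exists_apply_eq_left (hs : 2 ≤ s) (hT : IsIET s l r len π T)
    (hreg : IsRegularIET s l len T) : ∃ p : Fin s, (p : ℕ) ≠ 0 ∧ T (sepPt l len p) = l := by
  have hpre : ∀ z ∈ Set.Ico l r, ∃ w, T w = z ∧
      ∃ i, w ∈ Set.Ico (sepPt l len i) (sepPt l len i + len i) := by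
    intro z hz
    refine ⟨T⁻¹ z, perm_apply_inv T z, hT.exists_piece ?_⟩
    rwa [← hT.mem_iff, perm_apply_inv]
  obtain ⟨x, hx, p, hp⟩ := hpre l ⟨le_rfl, hT.1⟩
  have hxp : x = sepPt l len p := by
    have := hT.apply_piece hp
    have := ((hT.mem_iff _).2 (hT.sepPt_mem p)).1
    linarith [hp.1]
  subst hxp
  refine ⟨p, fun hp0 => ?_, hx⟩
  have hpl : sepPt l len p = l := sepPt_of_eq_zero l len hp0
  have hfix : ∀ z ∈ Set.Ico (sepPt l len p) (sepPt l len p + len p), T z = z := by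
    intro z hz
    rw [hT.apply_piece hz, hx, hpl]; ring
  set q : Fin s := ⟨1, by omega⟩ with hq
  have hpq : p < q := Fin.lt_def.2 (by simp [hq]; omega)
  have hq1 : sepPt l len q = sepPt l len p + len p := by
    refine le_antisymm ?_ (sepPt_add_le hT.2.1 hpq)
    have : Finset.univ.filter (fun k => k < q) ⊆ {p} := by
      intro k hk
      rw [Finset.mem_filter, Fin.lt_def] at hk
      rw [Finset.mem_singleton, Fin.ext_iff]
      have : (k : ℕ) < 1 := hk.2
      omega
    have h := Finset.sum_le_sum_of_subset_of_nonneg this fun k _ _ => (hT.2.1 k).le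
    rw [Finset.sum_singleton] at h
    rw [hpl, sepPt]
    linarith
  obtain ⟨y, hy, j, hj⟩ := hpre _ (hT.sepPt_mem q)
  have hjp : j ≠ p := by
    rintro rfl
    rw [hfix y hj] at hy
    linarith [hj.2]
  have hj0 : (j : ℕ) ≠ 0 := fun h => hjp (Fin.ext (h.trans hp0.symm))
  have hTj := ((hT.mem_iff _).2 (hT.sepPt_mem j)).1
  have hyj := hT.apply_piece hj
  rcases hj.1.eq_or_lt with heq | hlt
  · rw [← heq] at hy
    have hjq : j = q := hreg.eq_of_mem_orbitZ hj0 (by simp [hq]) (z := sepPt l len q)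
      ⟨1, by simpa using hy⟩ ⟨0, rfl⟩
    rw [hjq] at hy
    exact hreg.pow_sepPt_ne (n := 1) (i := q) (by simp [hq]) one_pos (by simpa using hy)
  · have hmem : T (sepPt l len j) ∈ Set.Ico (sepPt l len p) (sepPt l len p + len p) :=
      ⟨by rw [hpl]; exact hTj, by linarith⟩
    rw [T.injective (hfix _ hmem)] at hmem
    exact hjp (piece_unique hT.2.1 (hT.sepPt_mem_piece j) hmem)

theorem not_periodic (hs : 2 ≤ s) (hT : IsIET s l r len π T) (hreg : IsRegularIET s l len T)
    {z : ℝ} (hz : z ∈ Set.Ico l r) {n : ℕ} (hn : 0 < n) : (T ^ n) z ≠ z := by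
  intro hper
  choose idx hidx using fun h : ℕ => hT.exists_piece (hT.isPiecewiseTranslation.pow_mem hz h)
  obtain ⟨h₀, h₀n, hmin⟩ := (Finset.range n).exists_min_image
    (fun h => (T ^ h) z - sepPt l len (idx h)) ⟨0, Finset.mem_range.2 hn⟩
  rw [Finset.mem_range] at h₀n
  set d := (T ^ h₀) z - sepPt l len (idx h₀) with hd
  have hd0 : 0 ≤ d := sub_nonneg.2 (hidx h₀).1
  have hshift : ∀ h ≤ n, (T ^ h) (z - d) = (T ^ h) z - d := by
    intro h
    induction h with
    | zero => intro _; rfl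
    | succ h ih =>
      intro hh
      have h1 := hmin h (Finset.mem_range.2 hh)
      rw [pow_succ', Equiv.Perm.mul_apply, Equiv.Perm.mul_apply, ih (by omega),
        hT.apply_piece (hidx h), hT.apply_piece (i := idx h)
          ⟨by linarith, by linarith [(hidx h).2]⟩]
      ring
  have hzd : (T ^ n) (z - d) = z - d := by rw [hshift n le_rfl, hper]
  have hγ : (T ^ n) (sepPt l len (idx h₀)) = sepPt l len (idx h₀) := by
    have : sepPt l len (idx h₀) = (T ^ h₀) (z - d) := by
      rw [hshift h₀ h₀n.le, hd]; ring
    rw [this, ← Equiv.Perm.mul_apply, ← pow_add, add_comm, pow_add, Equiv.Perm.mul_apply, hzd]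
  by_cases hi : (idx h₀ : ℕ) = 0
  · rw [sepPt_of_eq_zero l len hi] at hγ
    obtain ⟨p, hp, hTp⟩ := hreg.exists_apply_eq_left hs hT
    refine hreg.pow_sepPt_ne hp hn (T.injective ?_)
    rw [← Equiv.Perm.mul_apply, ← pow_succ', pow_succ, Equiv.Perm.mul_apply, hTp, hγ]
  · exact hreg.pow_sepPt_ne hi hn hγ

theorem pow_ne_sepPt (hs : 2 ≤ s) (hT : IsIET s l r len π T) (hreg : IsRegularIET s l len T) :
    ∀ b ∈ insert l (sepSet l len), ∀ c ∈ sepSet l len, ∀ n : ℕ, 0 < n → (T ^ n) b ≠ c := by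
  have key : ∀ b ∈ sepSet l len, ∀ c ∈ sepSet l len, ∀ n : ℕ, 0 < n → (T ^ n) b ≠ c := by
    rintro _ ⟨i, hi, rfl⟩ _ ⟨j, hj, rfl⟩ n hn h
    obtain rfl := hreg.eq_of_mem_orbitZ hi hj (z := sepPt l len j) ⟨n, by rw [zpow_natCast, h]⟩
      ⟨0, rfl⟩
    exact hreg.pow_sepPt_ne hi hn h
  rintro b (rfl | hb) c hc n hn h
  · obtain ⟨p, hp, hTp⟩ := hreg.exists_apply_eq_left hs hT
    refine key _ ⟨p, hp, rfl⟩ c hc (n + 1) (by omega) ?_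
    rw [pow_succ, Equiv.Perm.mul_apply, hTp, h]
  · exact key b hb c hc n hn h

end IsRegularIET

theorem sum_len_lt_eq {n : ℕ} {l t : ℝ} {c len : Fin n → ℝ} (hlen : ∀ i, 0 < len i)
    (hdisj : ∀ i j, i ≠ j → Disjoint (Set.Ico (c i) (c i + len i)) (Set.Ico (c j) (c j + len j)))
    (hcover : ∀ z, z ∈ Set.Ico l t ↔ ∃ i, z ∈ Set.Ico (c i) (c i + len i)) {u : ℝ}
    (hlu : l ≤ u) (hut : u ≤ t) (hu : ∀ j, c j < u → c j + len j ≤ u) :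
    ∑ j ∈ Finset.univ.filter (fun j => c j < u), len j = u - l := by
  have hset : Set.Ico l u =
      ⋃ j ∈ Finset.univ.filter (fun j => c j < u), Set.Ico (c j) (c j + len j) := by
    ext z
    simp only [Set.mem_iUnion, Finset.mem_filter, Finset.mem_univ, true_and, exists_prop]
    constructor
    · intro hz
      obtain ⟨i, hi⟩ := (hcover z).1 ⟨hz.1, hz.2.trans_le hut⟩
      exact ⟨i, hi.1.trans_lt hz.2, hi⟩
    · rintro ⟨i, hi, hz⟩
      exact ⟨((hcover z).2 ⟨i, hz⟩).1, hz.2.trans_le (hu i hi)⟩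
  have hvol := congrArg volume hset
  rw [measure_biUnion_finset (fun i _ j _ hij => hdisj i j hij) fun _ _ => measurableSet_Ico,
    Real.volume_Ico] at hvol
  simp only [Real.volume_Ico, add_sub_cancel_left] at hvol
  rw [← ENNReal.ofReal_sum_of_nonneg fun i _ => (hlen i).le] at hvol
  exact ((ENNReal.ofReal_eq_ofReal_iff (by linarith)
    (Finset.sum_nonneg fun i _ => (hlen i).le)).1 hvol).symm

/-- A bijection of `[l,t)` that is a translation between consecutive points of `W` is an
interval exchange transformation whose separation points are the points of `W`. -/
theorem exists_isIET_of_translate {n : ℕ} {l t : ℝ} {W : Fin (n + 1) → ℝ}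
    (hW : Function.Injective W) (hW0 : W 0 = l) (hWI : ∀ j, W j ∈ Set.Ico l t)
    {S : Equiv.Perm ℝ} (hoff : ∀ z, z ∉ Set.Ico l t → S z = z)
    (htrans : ∀ x y, l ≤ x → x < y → y < t → (∀ j, W j ∉ Set.Ioc x y) → S y - y = S x - x) :
    ∃ (lam : Fin (n + 1) → ℝ) (σ τ : Equiv.Perm (Fin (n + 1))),
      IsIET (n + 1) l t lam σ S ∧ (∀ i, sepPt l lam i = W (τ i)) ∧ τ 0 = 0 := by
  have hlt : l < t := (hWI 0).1.trans_lt (hWI 0).2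
  set τ := Tuple.sort W with hτ
  set b : Fin (n + 1) → ℝ := fun i => W (τ i) with hb
  have hbmono : StrictMono b :=
    (Tuple.monotone_sort W).strictMono_of_injective (hW.comp τ.injective)
  have hbI : ∀ i, b i ∈ Set.Ico l t := fun i => hWI _
  have hWb : ∀ j, W j = b (τ.symm j) := fun j => by simp [hb]
  have hb0 : b 0 = l := by
    refine le_antisymm ?_ (hbI 0).1
    rw [← hW0, hWb]
    exact hbmono.monotone (Fin.zero_le _)
  have hτ0 : τ 0 = 0 := hW (hb0.trans hW0.symm)
  set lam : Fin (n + 1) → ℝ := fun i =>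
    (if h : (i : ℕ) + 1 < n + 1 then b ⟨i + 1, h⟩ else t) - b i with hlam
  have hlam_pos : ∀ i, 0 < lam i := by
    intro i
    simp only [hlam]
    split_ifs with h
    · exact sub_pos.2 (hbmono (Fin.lt_def.2 (by simp)))
    · exact sub_pos.2 (hbI i).2
  have hend_le : ∀ i j, i < j → b i + lam i ≤ b j := by
    intro i j hij
    rw [Fin.lt_def] at hij
    simp only [hlam]
    rw [dif_pos (by omega : (i : ℕ) + 1 < n + 1), add_sub_cancel]
    exact hbmono.monotone (Fin.le_def.2 hij)
  have hend_t : ∀ i, b i + lam i ≤ t := by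
    intro i
    simp only [hlam, add_sub_cancel]
    split_ifs
    · exact (hbI _).2.le
    · exact le_rfl
  have huniq : ∀ i j z, z ∈ Set.Ico (b i) (b i + lam i) → z ∈ Set.Ico (b j) (b j + lam j) →
      i = j := by
    intro i j z hi hj
    rcases lt_trichotomy i j with h | h | h
    · linarith [hend_le i j h, hi.2, hj.1]
    · exact h
    · linarith [hend_le j i h, hj.2, hi.1]
  have hcover : ∀ z, z ∈ Set.Ico l t ↔ ∃ i, z ∈ Set.Ico (b i) (b i + lam i) := by
    intro z
    constructor
    · intro hz
      obtain ⟨i, hi, hmax⟩ := (Finset.univ.filter (fun i => b i ≤ z)).exists_max_image id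
        ⟨0, by simpa [hb0] using hz.1⟩
      refine ⟨i, (Finset.mem_filter.1 hi).2, ?_⟩
      simp only [hlam, add_sub_cancel]
      split_ifs with h
      · by_contra hcon
        have := hmax ⟨i + 1, h⟩ (by simpa using hcon)
        simp [Fin.le_def] at this
      · exact hz.2
    · rintro ⟨i, hi⟩
      exact ⟨(hbI i).1.trans hi.1, hi.2.trans_le (hend_t i)⟩
  have hSpiece : ∀ i z, z ∈ Set.Ico (b i) (b i + lam i) → S z = z + (S (b i) - b i) := by
    intro i z hz
    rcases hz.1.eq_or_lt with rfl | hlt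
    · ring
    have := htrans (b i) z (hbI i).1 hlt (hz.2.trans_le (hend_t i)) (by
      intro j hj
      rw [hWb] at hj
      have h1 := hbmono.lt_iff_lt.1 hj.1
      linarith [hend_le _ _ h1, hj.2, hz.2])
    linarith
  have hSmem : ∀ z, S z ∈ Set.Ico l t ↔ z ∈ Set.Ico l t := by
    intro z
    constructor
    · intro h
      by_contra hz
      rw [hoff z hz] at h
      exact hz h
    · intro h
      by_contra hz
      rw [S.injective (hoff _ hz)] at hz
      exact hz h
  set c : Fin (n + 1) → ℝ := fun i => S (b i) with hc
  have himg : ∀ i z, z ∈ Set.Ico (c i) (c i + lam i) ↔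
      ∃ w ∈ Set.Ico (b i) (b i + lam i), S w = z := by
    intro i z
    constructor
    · intro hz
      have hw : b i + (z - c i) ∈ Set.Ico (b i) (b i + lam i) :=
        ⟨by linarith [hz.1], by linarith [hz.2]⟩
      exact ⟨_, hw, by rw [hSpiece i _ hw]; simp only [hc]; ring⟩
    · rintro ⟨w, hw, rfl⟩
      rw [hSpiece i w hw]
      simp only [hc]
      exact ⟨by linarith [hw.1], by linarith [hw.2]⟩
  have hcuniq : ∀ i j z, z ∈ Set.Ico (c i) (c i + lam i) → z ∈ Set.Ico (c j) (c j + lam j) →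
      i = j := by
    intro i j z hi hj
    obtain ⟨w, hw, rfl⟩ := (himg i z).1 hi
    obtain ⟨w', hw', he⟩ := (himg j _).1 hj
    rw [S.injective he] at hw'
    exact huniq i j w hw hw'
  have hccover : ∀ z, z ∈ Set.Ico l t ↔ ∃ i, z ∈ Set.Ico (c i) (c i + lam i) := by
    intro z
    obtain ⟨w, rfl⟩ := S.surjective z
    rw [hSmem, hcover]
    refine exists_congr fun i => ?_
    rw [himg]
    exact ⟨fun h => ⟨w, h, rfl⟩, fun ⟨w', hw', he⟩ => S.injective he ▸ hw'⟩
  have hcinj : Function.Injective c := S.injective.comp hbmono.injective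
  set σ : Equiv.Perm (Fin (n + 1)) := (Tuple.sort c).symm with hσ
  have hσlt : ∀ i j, σ j < σ i ↔ c j < c i := by
    intro i j
    have hm : StrictMono (c ∘ Tuple.sort c) :=
      (Tuple.monotone_sort c).strictMono_of_injective (hcinj.comp (Tuple.sort c).injective)
    rw [← hm.lt_iff_lt]
    simp [hσ]
  have hsep : ∀ i, sepPt l lam i = b i := by
    intro i
    have h := sum_len_lt_eq hlam_pos (fun i j hij => Set.disjoint_left.2 fun z hi hj =>
      hij (huniq i j z hi hj)) hcover (hbI i).1 (hbI i).2.le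
      (fun j hj => hend_le j i (hbmono.lt_iff_lt.1 hj))
    simp only [hbmono.lt_iff_lt] at h
    rw [sepPt, h]; ring
  have himgPt : ∀ i, imgPt l lam σ i = c i := by
    intro i
    have hci := (hSmem _).2 (hbI i)
    have h := sum_len_lt_eq hlam_pos (fun i j hij => Set.disjoint_left.2 fun z hi hj =>
      hij (hcuniq i j z hi hj)) hccover hci.1 hci.2.le (fun j hj => by
        by_contra hcon
        push Not at hcon
        have := hcuniq j i (c i) ⟨hj.le, hcon⟩ ⟨le_rfl, by linarith [hlam_pos i]⟩
        rw [this] at hj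
        exact lt_irrefl _ hj)
    simp only [imgPt, hσlt]
    rw [h]
    ring
  have hsum : ∑ i, lam i = t - l := by
    rw [← sum_len_lt_eq hlam_pos (fun i j hij => Set.disjoint_left.2 fun z hi hj =>
      hij (huniq i j z hi hj)) hcover hlt.le le_rfl fun j _ => hend_t j]
    rw [Finset.filter_true_of_mem fun i _ => (hbI i).2]
  refine ⟨lam, σ, τ, ⟨hlt, hlam_pos, hsum, hoff, fun i z hz => ?_⟩, hsep, hτ0⟩
  rw [hsep] at hz
  rw [himgPt, hsep]
  exact hSpiece i z hz

theorem entryPts_subset_of_rightAdmissible {s : ℕ} {l r t : ℝ} {len : Fin s → ℝ}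
    {T : Equiv.Perm ℝ} (ht : RightAdmissible s l r len T t) :
    entryPts T (insert t (sepSet l len)) l t ⊆ insert l (entryPts T (sepSet l len) l t) := by
  obtain ⟨hlt, -, i, k, rfl, hpos, hneg⟩ := ht
  set t := (T ^ k) (sepPt l len i) with htdef
  rintro w ⟨hw, h, hh | hh, hg⟩
  swap
  · exact Or.inr ⟨hw, h, hh, hg⟩
  have hzpow : ∀ m : ℤ, (T ^ (m - h + k)) (sepPt l len i) = (T ^ m) w := by
    intro m
    rw [zpow_add, Equiv.Perm.mul_apply, ← htdef, ← hh, ← Equiv.Perm.mul_apply,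
      ← zpow_natCast, ← zpow_add, sub_add_cancel]
  have hh0 : 0 < h := by
    rcases Nat.eq_zero_or_pos h with rfl | h0
    · rw [pow_zero, Equiv.Perm.one_apply] at hh
      exact absurd hw.2 (by rw [hh]; exact lt_irrefl _)
    · exact h0
  have hkh : k ≤ h := by
    by_contra hcon
    push Not at hcon
    have := hpos (by omega) (k - h) (by omega) (by omega)
    have e := hzpow 0
    rw [zero_sub, neg_add_eq_sub, zpow_zero, Equiv.Perm.one_apply] at e
    rw [e] at this
    exact lt_asymm hw.2 this
  have hγ : (T ^ (h - k).toNat) w = sepPt l len i := by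
    have e := hzpow (h - k)
    rw [show (h : ℤ) - k - h + k = 0 by ring, zpow_zero, Equiv.Perm.one_apply] at e
    rw [e, ← zpow_natCast, Int.toNat_of_nonneg (by omega)]
  have hout : ∀ g : ℕ, 0 < g → g ≤ (h - k).toNat → (T ^ g) w ∉ Set.Ico l t := by
    intro g hg0 hgle hmem
    by_cases hgh : g ≤ h
    · exact hg g hg0 hgh hmem
    · push Not at hgh
      have := hneg (by omega) (g - h + k) (by omega) (by omega)
      rw [hzpow, zpow_natCast] at this
      exact lt_asymm hmem.2 this
  by_cases hi : (i : ℕ) = 0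
  · left
    rw [sepPt_of_eq_zero l len hi] at hγ
    rcases Nat.eq_zero_or_pos (h - k).toNat with h0 | h0
    · simpa [h0] using hγ
    · exact absurd (by rw [hγ]; exact ⟨le_rfl, hlt⟩) (hout _ h0 le_rfl)
  · exact Or.inr ⟨hw, _, ⟨i, hi, hγ.symm⟩, hout⟩

theorem exists_entry {f : Equiv.Perm ℝ} {I : Set ℝ} {z : ℝ}
    (h : ∃ n : ℕ, ∃ x ∈ I, (f ^ n) x = z) :
    ∃ w ∈ I, ∃ n : ℕ, (f ^ n) w = z ∧ ∀ g : ℕ, 0 < g → g ≤ n → (f ^ g) w ∉ I := by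
  classical
  obtain ⟨x, hx, hxz⟩ := Nat.find_spec h
  refine ⟨x, hx, _, hxz, fun g hg hgn hmem => ?_⟩
  refine Nat.find_min h (Nat.sub_lt (hg.trans_le hgn) hg) ⟨_, hmem, ?_⟩
  rw [← Equiv.Perm.mul_apply, ← pow_add, Nat.sub_add_cancel hgn, hxz]

theorem IsPiecewiseTranslation.exists_perm_eq_inducedMap {f : Equiv.Perm ℝ} {l r t : ℝ}
    {C C' : Set ℝ} (hf : IsPiecewiseTranslation f l r C)
    (hf' : IsPiecewiseTranslation f⁻¹ l r C') (htr : t ≤ r) :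
    ∃ S : Equiv.Perm ℝ, (∀ z, z ∉ Set.Ico l t → S z = z) ∧
      ∀ z ∈ Set.Ico l t, S z = inducedMap f (Set.Ico l t) z := by
  classical
  set I := Set.Ico l t with hI
  set F : ℝ → ℝ := fun z => if z ∈ I then inducedMap f I z else z with hF
  have hin : ∀ z ∈ I, F z = inducedMap f I z := fun z hz => if_pos hz
  have hout : ∀ z, z ∉ I → F z = z := fun z hz => if_neg hz
  have hmem : ∀ z, F z ∈ I ↔ z ∈ I := by
    intro z
    by_cases hz : z ∈ I
    · rw [hin z hz]
      exact iff_of_true (hf.returnTime_spec htr hz).2 hz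
    · rw [hout z hz]
  have hinj : Function.Injective F := by
    have key : ∀ x ∈ I, ∀ y ∈ I, returnTime f I x ≤ returnTime f I y → F x = F y → x = y := by
      intro x hx y hy hle hxy
      rw [hin x hx, hin y hy] at hxy
      have e := pow_apply_eq_pow_sub_apply hle hxy
      have hpos : 0 < returnTime f I x := (hf.returnTime_spec htr hx).1
      rcases Nat.eq_zero_or_pos (returnTime f I y - returnTime f I x) with h0 | h0
      · simpa [h0] using e
      · exact absurd (e ▸ hx) (pow_notMem_of_lt_returnTime h0 (by omega))
    intro x y hxy
    by_cases hx : x ∈ I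
    · have hy : y ∈ I := by rwa [← hmem, ← hxy, hmem]
      rcases le_total (returnTime f I x) (returnTime f I y) with h | h
      · exact key x hx y hy h hxy
      · exact (key y hy x hx h hxy.symm).symm
    · have hy : y ∉ I := by rwa [← hmem, ← hxy, hmem]
      rwa [hout x hx, hout y hy] at hxy
  have hsurj : Function.Surjective F := by
    intro y
    by_cases hy : y ∈ I
    · obtain ⟨hpos, hmemI⟩ := hf'.returnTime_spec htr hy
      have hpow : ∀ g ≤ returnTime f⁻¹ I y,
          (f ^ g) (inducedMap f⁻¹ I y) = (f⁻¹ ^ (returnTime f⁻¹ I y - g)) y := by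
        intro g hg
        unfold inducedMap
        conv_lhs => rw [← Nat.add_sub_cancel' hg, pow_add f⁻¹, Equiv.Perm.mul_apply, inv_pow f g,
          perm_apply_inv]
      have hlast := hpow _ le_rfl
      rw [Nat.sub_self, pow_zero, Equiv.Perm.one_apply] at hlast
      have htime : returnTime f I (inducedMap f⁻¹ I y) = returnTime f⁻¹ I y := by
        refine returnTime_eq hpos (by rwa [hlast]) fun g hg hlt => ?_
        rw [hpow g hlt.le]
        exact pow_notMem_of_lt_returnTime (by omega) (by omega)
      refine ⟨inducedMap f⁻¹ I y, ?_⟩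
      rw [hin _ hmemI]
      conv_lhs => rw [inducedMap, htime, hlast]
    · exact ⟨y, hout y hy⟩
  exact ⟨Equiv.ofBijective F ⟨hinj, hsurj⟩, hout, hin⟩

theorem exists_pow_eq_of_return {S T : Equiv.Perm ℝ} {I : Set ℝ}
    (hret : ∀ z ∈ I, ∃ k : ℕ, 0 < k ∧ S z = (T ^ k) z ∧ S z ∈ I) {z : ℝ} (hz : z ∈ I) (m : ℕ) :
    ∃ k : ℕ, m ≤ k ∧ (S ^ m) z = (T ^ k) z ∧ (S ^ m) z ∈ I := by
  induction m with
  | zero => exact ⟨0, le_rfl, rfl, hz⟩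
  | succ m ih =>
    obtain ⟨k, hmk, hk, hkI⟩ := ih
    obtain ⟨k', hk'0, hk', hk'I⟩ := hret _ hkI
    rw [pow_succ', Equiv.Perm.mul_apply]
    refine ⟨k' + k, by omega, ?_, hk'I⟩
    rw [hk', hk, pow_add, Equiv.Perm.mul_apply]

theorem orbitZ_subset_of_return {S T : Equiv.Perm ℝ} {I : Set ℝ}
    (hSI : ∀ z, S z ∈ I ↔ z ∈ I)
    (hret : ∀ z ∈ I, ∃ k : ℕ, 0 < k ∧ S z = (T ^ k) z ∧ S z ∈ I) {z : ℝ} (hz : z ∈ I) :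
    orbitZ S z ⊆ orbitZ T z := by
  rintro _ ⟨m, rfl⟩
  obtain ⟨m, rfl | rfl⟩ := m.eq_nat_or_neg
  · obtain ⟨k, -, hk, -⟩ := exists_pow_eq_of_return hret hz m
    exact ⟨k, by rw [zpow_natCast, zpow_natCast, hk]⟩
  · have hpowI : ∀ (m : ℕ) (v : ℝ), (S ^ m) v ∈ I → v ∈ I := by
      intro m
      induction m with
      | zero => exact fun v hv => hv
      | succ m ih =>
        intro v hv
        rw [pow_succ', Equiv.Perm.mul_apply, hSI] at hv
        exact ih v hv
    rw [zpow_neg, zpow_natCast]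
    have hv : (S ^ m) ((S ^ m)⁻¹ z) = z := perm_apply_inv _ _
    obtain ⟨k, -, hk, -⟩ := exists_pow_eq_of_return hret (hpowI m _ (hv.symm ▸ hz)) m
    refine ⟨-k, ?_⟩
    rw [zpow_neg, zpow_natCast, Equiv.Perm.inv_eq_iff_eq, ← hk, hv]

theorem orbitZ_subset_orbitZ_pow {T : Equiv.Perm ℝ} {z : ℝ} (h : ℕ) :
    orbitZ T z ⊆ orbitZ T ((T ^ h) z) := by
  rintro _ ⟨m, rfl⟩
  refine ⟨m - h, ?_⟩
  rw [← Equiv.Perm.mul_apply, ← zpow_natCast, ← zpow_add, sub_add_cancel]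

theorem orbitZ_infinite {S : Equiv.Perm ℝ} {z : ℝ} (h : ∀ k : ℕ, 0 < k → (S ^ k) z ≠ z) :
    (orbitZ S z).Infinite := by
  refine (Set.infinite_range_of_injective (f := fun k : ℕ => (S ^ k) z) fun a b hab => ?_).mono ?_
  · by_contra hne
    rcases lt_or_gt_of_ne hne with hlt | hlt
    · exact h (b - a) (by omega) (pow_apply_eq_pow_sub_apply hlt.le hab).symm
    · exact h (a - b) (by omega) (pow_apply_eq_pow_sub_apply hlt.le hab.symm).symm
  · rintro _ ⟨k, rfl⟩
    exact ⟨k, by rw [zpow_natCast]⟩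

/-- Rauzy. The transformation induced by a regular `s`-interval
exchange transformation on a right admissible semi-interval is a regular
`s`-interval exchange transformation. -/
theorem induced_on_rightAdmissible_regular (s : ℕ) (hs : 2 ≤ s) (l r : ℝ)
    (len : Fin s → ℝ) (π : Equiv.Perm (Fin s)) (T : Equiv.Perm ℝ)
    (hIET : IsIET s l r len π T) (hreg : IsRegularIET s l len T)
    (t : ℝ) (ht : RightAdmissible s l r len T t) :
    ∃ (lam : Fin s → ℝ) (σ : Equiv.Perm (Fin s)) (S : Equiv.Perm ℝ),
      IsIET s l t lam σ S ∧ IsRegularIET s l lam S ∧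
      ∀ z ∈ Set.Ico l t, S z = inducedMap T (Set.Ico l t) z := by
  obtain ⟨n, rfl⟩ : ∃ n, s = n + 1 := ⟨s - 1, by omega⟩
  have hf := hIET.isPiecewiseTranslation
  have hf' := hIET.isPiecewiseTranslation_inv
  have hlt : l < t := ht.1
  have htr : t ≤ r := ht.2.1.le
  have hlI : l ∈ Set.Ico l t := ⟨le_rfl, hlt⟩
  have hentry : ∀ j : Fin (n + 1), ∃ w ∈ Set.Ico l t, (j = 0 → w = l) ∧
      (j ≠ 0 → ∃ h : ℕ, (T ^ h) w = sepPt l len j ∧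
        ∀ g : ℕ, 0 < g → g ≤ h → (T ^ g) w ∉ Set.Ico l t) := by
    intro j
    by_cases hj : j = 0
    · exact ⟨l, hlI, fun _ => rfl, fun h => absurd hj h⟩
    · obtain ⟨w, hw, hw'⟩ := exists_entry (hf.exists_pow_eq hf'
        (fun z hz n hn => hreg.not_periodic hs hIET hz hn) (hreg.pow_ne_sepPt hs hIET)
        hlt htr (hIET.sepPt_mem j))
      exact ⟨w, hw, fun h => absurd h hj, fun _ => hw'⟩
  choose W hWI hW0 hWsep using hentry
  have hval : ∀ {j : Fin (n + 1)}, j ≠ 0 → (j : ℕ) ≠ 0 := fun hj h => hj (Fin.ext h)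
  have horb : ∀ j ≠ 0, orbitZ T (W j) ⊆ orbitZ T (sepPt l len j) := by
    intro j hj
    obtain ⟨h, hh, -⟩ := hWsep j hj
    exact hh ▸ orbitZ_subset_orbitZ_pow h
  have hWl : ∀ j ≠ 0, W j ≠ l := by
    intro j hj hl
    obtain ⟨h, hh, -⟩ := hWsep j hj
    rw [hl] at hh
    rcases Nat.eq_zero_or_pos h with rfl | hpos
    · exact (lt_sepPt hIET.2.1 (hval hj)).ne hh
    · exact hreg.pow_ne_sepPt hs hIET l (Set.mem_insert _ _) _ ⟨j, hval hj, rfl⟩ h hpos hh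
  have hWinj : Function.Injective W := by
    intro i j hij
    by_cases hi : i = 0
    · by_contra hne
      exact hWl j (fun h => hne (hi.trans h.symm)) (hij ▸ hW0 i hi)
    · by_cases hj : j = 0
      · exact absurd (hij.trans (hW0 j hj)) (hWl i hi)
      · exact hreg.eq_of_mem_orbitZ (hval hi) (hval hj) (horb i hi ⟨0, rfl⟩)
          (hij ▸ horb j hj ⟨0, rfl⟩)
  have hEW : ∀ w ∈ entryPts T (insert t (sepSet l len)) l t, ∃ j, w = W j := by
    intro w hw
    rcases entryPts_subset_of_rightAdmissible ht hw with rfl | ⟨hwI, h, ⟨j, hj, hh⟩, hg⟩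
    · exact ⟨0, (hW0 0 rfl).symm⟩
    · obtain ⟨h', hh', hg'⟩ := hWsep j (fun h0 => hj (by rw [h0]; rfl))
      exact ⟨j, entry_unique hwI (hWI j) hg hg' (hh.symm.trans hh'.symm)⟩
  obtain ⟨S, hoff, hS⟩ := hf.exists_perm_eq_inducedMap hf' htr
  have hret : ∀ z ∈ Set.Ico l t, ∃ k : ℕ, 0 < k ∧ S z = (T ^ k) z ∧ S z ∈ Set.Ico l t := by
    intro z hz
    obtain ⟨hpos, hmem⟩ := hf.returnTime_spec htr hz
    exact ⟨_, hpos, hS z hz, by rwa [hS z hz]⟩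
  obtain ⟨lam, σ, τ, hSIET, hsep, hτ⟩ := exists_isIET_of_translate hWinj (hW0 0 rfl) hWI hoff (by
    intro x y hx hxy hy hno
    rw [hS x ⟨hx, hxy.trans hy⟩, hS y ⟨hx.trans hxy.le, hy⟩]
    refine (hf.returnTime_eq_and_inducedMap htr hx hxy.le hy fun w hw hwI => ?_).2
    obtain ⟨j, rfl⟩ := hEW w hw
    exact hno j hwI)
  have hτne : ∀ i : Fin (n + 1), (i : ℕ) ≠ 0 → τ i ≠ 0 := by
    intro i hi h
    exact hi (by rw [τ.injective (h.trans hτ.symm)]; rfl)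
  refine ⟨lam, σ, S, hSIET, ⟨fun i hi => ?_, fun i j hi hj hij => ?_⟩, hS⟩
  · rw [hsep]
    refine orbitZ_infinite fun k hk hper => ?_
    obtain ⟨m, hkm, hm⟩ := exists_pow_eq_of_return hret (hWI (τ i)) k
    exact hreg.not_periodic hs hIET ⟨(hWI (τ i)).1, (hWI (τ i)).2.trans_le htr⟩
      (hk.trans_le hkm) (hm.1.symm.trans hper)
  · rw [hsep, hsep, Set.disjoint_left]
    intro z hzi hzj
    have hsub := fun i => orbitZ_subset_of_return hSIET.mem_iff hret (hWI (τ i))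
    exact hij (τ.injective (hreg.eq_of_mem_orbitZ (hval (hτne i hi)) (hval (hτne j hj))
      (horb _ (hτne i hi) (hsub i hzi)) (horb _ (hτne j hj) (hsub j hzj))))

end
end

section
/- Let T be a minimal s-interval exchange transformation on [ℓ,r). For every semi-interval I ⊆ [ℓ,r), the transformation induced by T on I is an interval exchange transformation on at most s+2 semi-intervals. -/
open Set MeasureTheory

noncomputable section

/-- Disjoint semi-intervals contained in `[u,v)` have total length at most `v - u`. -/
theorem sum_le_of_pairwiseDisjoint_Ico {ι : Type*} {A : Finset ι} {x lam : ι → ℝ} {u v : ℝ}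
    (huv : u ≤ v) (hlam : ∀ i ∈ A, 0 ≤ lam i)
    (hd : (A : Set ι).PairwiseDisjoint fun i => Set.Ico (x i) (x i + lam i))
    (hs : ∀ i ∈ A, Set.Ico (x i) (x i + lam i) ⊆ Set.Ico u v) :
    ∑ i ∈ A, lam i ≤ v - u := by
  have h1 := measure_biUnion_finset (μ := volume) hd fun i _ => measurableSet_Ico
  have h2 : volume (⋃ i ∈ A, Set.Ico (x i) (x i + lam i)) ≤ volume (Set.Ico u v) :=
    measure_mono (Set.iUnion₂_subset hs)
  rw [h1] at h2
  simp only [Real.volume_Ico, add_sub_cancel_left] at h2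
  rw [← ENNReal.ofReal_sum_of_nonneg hlam] at h2
  exact (ENNReal.ofReal_le_ofReal_iff (sub_nonneg.2 huv)).1 h2

/-- Disjoint semi-intervals that tile `[u,v)` have total length `v - u`. -/
theorem sum_eq_of_iUnion_Ico_eq {ι : Type*} [Fintype ι] {x lam : ι → ℝ} {u v : ℝ}
    (huv : u ≤ v) (hlam : ∀ i, 0 ≤ lam i)
    (hd : Pairwise fun i j => Disjoint (Set.Ico (x i) (x i + lam i)) (Set.Ico (x j) (x j + lam j)))
    (hs : ⋃ i, Set.Ico (x i) (x i + lam i) = Set.Ico u v) :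
    ∑ i, lam i = v - u := by
  have h1 := measure_iUnion (μ := volume) hd fun i => measurableSet_Ico
  rw [hs, tsum_fintype] at h1
  simp only [Real.volume_Ico, add_sub_cancel_left] at h1
  rw [← ENNReal.ofReal_sum_of_nonneg fun i _ => hlam i] at h1
  exact ((ENNReal.ofReal_eq_ofReal_iff (sub_nonneg.2 huv)
    (Finset.sum_nonneg fun i _ => hlam i)).1 h1).symm

theorem le_of_disjoint_Ico {a b c d : ℝ} (hcd : c < d)
    (h : Disjoint (Set.Ico a b) (Set.Ico c d)) (hac : a ≤ c) : b ≤ c := by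
  rw [Set.Ico_disjoint_Ico] at h
  by_contra! hcb
  rw [max_eq_right hac] at h
  exact absurd h (not_le.2 (lt_min hcb hcd))

section Tiling

variable {ι : Type*} [Fintype ι] {x lam : ι → ℝ} {u v : ℝ}

/-- In a family of disjoint semi-intervals of `[u,v)` of full total length, each one starts
where the total length of the preceding ones ends. -/
theorem start_eq_of_tiling (hlam : ∀ i, 0 < lam i)
    (hd : Pairwise fun i j => Disjoint (Set.Ico (x i) (x i + lam i)) (Set.Ico (x j) (x j + lam j)))
    (hs : ∀ i, Set.Ico (x i) (x i + lam i) ⊆ Set.Ico u v) (htot : ∑ i, lam i = v - u) (i : ι) :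
    u + ∑ j ∈ Finset.univ.filter (fun j => x j < x i), lam j = x i := by
  have hb : ∀ j, u ≤ x j ∧ x j + lam j ≤ v := fun j =>
    (Set.Ico_subset_Ico_iff (lt_add_of_pos_right _ (hlam j))).1 (hs j)
  have hle : ∀ i j, i ≠ j → x i ≤ x j → x i + lam i ≤ x j := fun i j hij h =>
    le_of_disjoint_Ico (lt_add_of_pos_right _ (hlam j))
      (hd hij) h
  have h1 : ∑ j ∈ Finset.univ.filter (fun j => x j < x i), lam j ≤ x i - u := by
    refine sum_le_of_pairwiseDisjoint_Ico (x := x) (hb i).1 (fun j _ => (hlam j).le)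
      (fun j _ k _ hjk => hd hjk) fun j hj => ?_
    have hj' : x j < x i := (Finset.mem_filter.1 hj).2
    refine Set.Ico_subset_Ico (hb j).1 (hle j i ?_ hj'.le)
    rintro rfl
    exact lt_irrefl _ hj'
  have h2 : ∑ j ∈ Finset.univ.filter (fun j => ¬ x j < x i), lam j ≤ v - x i := by
    refine sum_le_of_pairwiseDisjoint_Ico (x := x) (by linarith [hb i, hlam i])
      (fun j _ => (hlam j).le) (fun j _ k _ hjk => hd hjk) fun j hj => ?_
    exact Set.Ico_subset_Ico (not_lt.1 (Finset.mem_filter.1 hj).2) (hb j).2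
  have h3 := Finset.sum_filter_add_sum_filter_not Finset.univ (fun j => x j < x i) lam
  linarith

/-- Disjoint semi-intervals of `[u,v)` of full total length cover `[u,v)`. -/
theorem exists_mem_of_tiling (hlam : ∀ i, 0 < lam i)
    (hd : Pairwise fun i j => Disjoint (Set.Ico (x i) (x i + lam i)) (Set.Ico (x j) (x j + lam j)))
    (hs : ∀ i, Set.Ico (x i) (x i + lam i) ⊆ Set.Ico u v) (htot : ∑ i, lam i = v - u)
    {y : ℝ} (hy : y ∈ Set.Ico u v) : ∃ i, y ∈ Set.Ico (x i) (x i + lam i) := by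
  by_contra! hne
  have hb : ∀ j, u ≤ x j ∧ x j + lam j ≤ v := fun j =>
    (Set.Ico_subset_Ico_iff (lt_add_of_pos_right _ (hlam j))).1 (hs j)
  have h1 : ∑ j ∈ Finset.univ.filter (fun j => x j ≤ y), lam j ≤ y - u := by
    refine sum_le_of_pairwiseDisjoint_Ico (x := x) hy.1 (fun j _ => (hlam j).le)
      (fun j _ k _ hjk => hd hjk) fun j hj => ?_
    refine Set.Ico_subset_Ico (hb j).1 ?_
    by_contra! h
    exact hne j ⟨(Finset.mem_filter.1 hj).2, h⟩
  have h3 := Finset.sum_filter_add_sum_filter_not Finset.univ (fun j => x j ≤ y) lam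
  rcases (Finset.univ.filter fun j => ¬ x j ≤ y).eq_empty_or_nonempty with h0 | h0
  · rw [h0, Finset.sum_empty] at h3
    linarith [hy.2]
  · obtain ⟨m, hm, hmin⟩ := Finset.exists_min_image _ x h0
    have hm' := (Finset.mem_filter.1 hm).2
    have h2 : ∑ j ∈ Finset.univ.filter (fun j => ¬ x j ≤ y), lam j ≤ v - x m :=
      sum_le_of_pairwiseDisjoint_Ico (x := x) (by linarith [hb m, hlam m])
        (fun j _ => (hlam j).le) (fun j _ k _ hjk => hd hjk) fun j hj =>
          Set.Ico_subset_Ico (hmin j hj) (hb j).2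
    linarith

end Tiling

/-- An injective map of `[u,v)` into itself which is a translation on each of `k` consecutive
semi-intervals `[e i, e i + lam i)` is a `k`-interval exchange transformation. -/
theorem exists_isIET_of_piecewise_translation {k : ℕ} {u v : ℝ} (huv : u < v) {e lam c : Fin k → ℝ}
    (he : StrictMono e) (hlam : ∀ i, 0 < lam i)
    (hd : Pairwise fun i j => Disjoint (Set.Ico (e i) (e i + lam i)) (Set.Ico (e j) (e j + lam j)))
    (hU : ⋃ i, Set.Ico (e i) (e i + lam i) = Set.Ico u v)
    {f : ℝ → ℝ} (hf : ∀ i, ∀ z ∈ Set.Ico (e i) (e i + lam i), f z = z + c i)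
    (hmaps : Set.MapsTo f (Set.Ico u v) (Set.Ico u v)) (hinj : Set.InjOn f (Set.Ico u v)) :
    ∃ (σ : Equiv.Perm (Fin k)) (S : Equiv.Perm ℝ), IsIET k u v lam σ S ∧
      ∀ z ∈ Set.Ico u v, S z = f z := by
  classical
  have htot := sum_eq_of_iUnion_Ico_eq huv.le (fun i => (hlam i).le) hd hU
  have hs : ∀ i, Set.Ico (e i) (e i + lam i) ⊆ Set.Ico u v := fun i =>
    hU ▸ Set.subset_iUnion (fun i => Set.Ico (e i) (e i + lam i)) i
  have hpre : ∀ i, ∀ y ∈ Set.Ico (e i + c i) (e i + c i + lam i),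
      y - c i ∈ Set.Ico (e i) (e i + lam i) ∧ f (y - c i) = y := by
    intro i y hy
    have h : y - c i ∈ Set.Ico (e i) (e i + lam i) := ⟨by linarith [hy.1], by linarith [hy.2]⟩
    exact ⟨h, by rw [hf i _ h]; ring⟩
  have hs' : ∀ i, Set.Ico (e i + c i) (e i + c i + lam i) ⊆ Set.Ico u v := by
    intro i y hy
    obtain ⟨h1, h2⟩ := hpre i y hy
    exact h2 ▸ hmaps (hs i h1)
  have hd' : Pairwise fun i j => Disjoint (Set.Ico (e i + c i) (e i + c i + lam i))
      (Set.Ico (e j + c j) (e j + c j + lam j)) := by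
    intro i j hij
    refine Set.disjoint_left.2 fun y hi hj => ?_
    obtain ⟨h1, h2⟩ := hpre i y hi
    obtain ⟨h3, h4⟩ := hpre j y hj
    have := hinj (hs i h1) (hs j h3) (h2.trans h4.symm)
    exact Set.disjoint_left.1 (hd hij) h1 (this ▸ h3)
  set δ : Fin k → ℝ := fun i => e i + c i with hδ
  have hδinj : Function.Injective δ := by
    intro i j hij
    by_contra hne
    have hm : δ i ∈ Set.Ico (δ i) (δ i + lam i) := ⟨le_rfl, by linarith [hlam i]⟩
    have hm' : δ i ∈ Set.Ico (δ j) (δ j + lam j) := ⟨hij.ge, by linarith [hlam j]⟩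
    exact Set.disjoint_left.1 (hd' hne) hm hm'
  have hmono : StrictMono (δ ∘ Tuple.sort δ) :=
    (Tuple.monotone_sort δ).strictMono_of_injective (hδinj.comp (Tuple.sort δ).injective)
  have hσ : ∀ i j, (Tuple.sort δ).symm i < (Tuple.sort δ).symm j ↔ δ i < δ j := by
    intro i j
    rw [← hmono.lt_iff_lt]
    simp
  have hsep : ∀ i, sepPt u lam i = e i := by
    intro i
    rw [← start_eq_of_tiling hlam hd hs htot i]
    simp only [sepPt, he.lt_iff_lt]
  have himg : ∀ i, imgPt u lam (Tuple.sort δ).symm i = δ i := by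
    intro i
    rw [← start_eq_of_tiling (x := δ) hlam hd' hs' htot i]
    simp only [imgPt, hσ]
  have hsurj : Set.SurjOn f (Set.Ico u v) (Set.Ico u v) := by
    intro y hy
    obtain ⟨i, hi⟩ := exists_mem_of_tiling hlam hd' hs' htot hy
    exact ⟨_, hs i (hpre i y hi).1, (hpre i y hi).2⟩
  set g : ℝ → ℝ := fun z => if z ∈ Set.Ico u v then f z else z with hg
  have hgin : ∀ z ∈ Set.Ico u v, g z = f z := fun z hz => if_pos hz
  have hgout : ∀ z, z ∉ Set.Ico u v → g z = z := fun z hz => if_neg hz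
  have hgbij : Function.Bijective g := by
    refine ⟨fun z w hzw => ?_, fun y => ?_⟩
    · by_cases hz : z ∈ Set.Ico u v <;> by_cases hw : w ∈ Set.Ico u v
      · rw [hgin z hz, hgin w hw] at hzw
        exact hinj hz hw hzw
      · rw [hgin z hz, hgout w hw] at hzw
        exact absurd (hzw ▸ hmaps hz) hw
      · rw [hgout z hz, hgin w hw] at hzw
        exact absurd (hzw ▸ hmaps hw) hz
      · rwa [hgout z hz, hgout w hw] at hzw
    · by_cases hy : y ∈ Set.Ico u v
      · obtain ⟨z, hz, h⟩ := hsurj hy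
        exact ⟨z, (hgin z hz).trans h⟩
      · exact ⟨y, hgout y hy⟩
  refine ⟨(Tuple.sort δ).symm, Equiv.ofBijective g hgbij,
    ⟨huv, hlam, htot, fun z hz => hgout z hz, fun i z hz => ?_⟩, fun z hz => hgin z hz⟩
  rw [hsep] at hz
  rw [hsep, himg, Equiv.ofBijective_apply, hgin z (hs i hz), hf i z hz, hδ]
  ring

section IET

variable {s : ℕ} {l r : ℝ} {len : Fin s → ℝ} {π : Equiv.Perm (Fin s)} {T : Equiv.Perm ℝ}

theorem IsIET.apply_mem (hT : IsIET s l r len π T) {z : ℝ} (hz : z ∈ Set.Ico l r) :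
    T z ∈ Set.Ico l r := by
  by_contra h
  have := T.injective (hT.2.2.2.1 _ h)
  exact h (this.symm ▸ hz)

theorem IsIET.pow_apply_mem (hT : IsIET s l r len π T) (n : ℕ) {z : ℝ} (hz : z ∈ Set.Ico l r) :
    (T ^ n) z ∈ Set.Ico l r := by
  induction n with
  | zero => exact hz
  | succ n ih =>
    rw [pow_succ', Equiv.Perm.mul_apply]
    exact hT.apply_mem ih

theorem IsIET.exists_sepPt_eq (hT : IsIET s l r len π T) :
    ∃ i : Fin s, sepPt l len i = l := by
  rcases Nat.eq_zero_or_pos s with rfl | hs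
  · have h1 := hT.2.2.1
    have h2 := hT.1
    simp at h1
    linarith
  · refine ⟨⟨0, hs⟩, ?_⟩
    rw [sepPt, Finset.sum_eq_zero, add_zero]
    intro j hj
    exact absurd (Finset.mem_filter.1 hj).2 (by simp [Fin.lt_def])

/-- Each exchanged semi-interval ends at `r` or at a later separation point. -/
theorem IsIET.sepPt_add_len (hT : IsIET s l r len π T) (i : Fin s) :
    sepPt l len i + len i = r ∨ ∃ j, i < j ∧ sepPt l len j = sepPt l len i + len i := by
  classical
  by_cases h : (i : ℕ) + 1 < s
  · refine Or.inr ⟨⟨i + 1, h⟩, by simp [Fin.lt_def], ?_⟩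
    have : Finset.univ.filter (fun j : Fin s => j < ⟨i + 1, h⟩) =
        insert i (Finset.univ.filter fun j => j < i) := by
      ext j
      simp only [Finset.mem_filter, Finset.mem_univ, true_and, Finset.mem_insert, Fin.lt_def,
        Fin.ext_iff]
      omega
    rw [sepPt, this, Finset.sum_insert (by simp), sepPt]
    ring
  · left
    have : (Finset.univ : Finset (Fin s)) = insert i (Finset.univ.filter fun j => j < i) := by
      ext j
      simp only [Finset.mem_filter, Finset.mem_univ, true_and, Finset.mem_insert, Fin.lt_def,
        Fin.ext_iff, true_iff]
      have := j.isLt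
      omega
    have htot := hT.2.2.1
    rw [this, Finset.sum_insert (by simp)] at htot
    rw [sepPt]
    linarith

/-- The separation points other than `l`. -/
def interiorSep (l : ℝ) (len : Fin s → ℝ) : Finset ℝ :=
  (Finset.univ.image (sepPt l len)).erase l

theorem IsIET.card_interiorSep (hT : IsIET s l r len π T) : (interiorSep l len).card + 1 ≤ s := by
  obtain ⟨i, hi⟩ := hT.exists_sepPt_eq
  rw [interiorSep, Finset.card_erase_add_one (Finset.mem_image.2 ⟨i, Finset.mem_univ _, hi⟩)]
  exact Finset.card_image_le.trans (by simp)

theorem IsIET.exists_translation (hT : IsIET s l r len π T) {a b : ℝ} (hla : l ≤ a)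
    (hbr : b ≤ r) (h : ∀ p ∈ interiorSep l len, p ∉ Set.Ioo a b) :
    ∃ c, ∀ z ∈ Set.Ico a b, T z = z + c := by
  classical
  obtain ⟨i₀, hi₀⟩ := hT.exists_sepPt_eq
  obtain ⟨i, hi, hmax⟩ := Finset.exists_max_image
    (Finset.univ.filter fun i : Fin s => sepPt l len i ≤ a) id
    ⟨i₀, Finset.mem_filter.2 ⟨Finset.mem_univ _, hi₀.trans_le hla⟩⟩
  have hia := (Finset.mem_filter.1 hi).2
  have hb : b ≤ sepPt l len i + len i := by
    rcases hT.sepPt_add_len i with hr | ⟨j, hij, hj⟩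
    · rwa [hr]
    · have hja : a < sepPt l len j := by
        by_contra! hja
        exact absurd (hmax j (Finset.mem_filter.2 ⟨Finset.mem_univ _, hja⟩)) (not_le.2 hij)
      rw [← hj]
      by_contra! hjb
      exact h _ (Finset.mem_erase.2 ⟨(hla.trans_lt hja).ne',
        Finset.mem_image_of_mem _ (Finset.mem_univ j)⟩) ⟨hja, hjb⟩
  exact ⟨_, fun z hz => hT.2.2.2.2 i z ⟨hia.trans hz.1, hz.2.trans_le hb⟩⟩

/-- The points whose first backward visits to `(u,v)` bound the pieces of the induced map. -/
def breakPts (l : ℝ) (len : Fin s → ℝ) (u v : ℝ) : Finset ℝ :=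
  insert u (insert v (interiorSep l len))

open Classical in
/-- The left endpoints of the pieces of the map induced on `[u,v)`. -/
def inducedSep (l : ℝ) (len : Fin s → ℝ) (T : Equiv.Perm ℝ) (u v : ℝ) : Finset ℝ :=
  insert u (((breakPts l len u v).image fun p => (T⁻¹ ^ rhoMinusPt T u v p) p).filter
    fun q => q ∈ Set.Ioo u v)

theorem IsIET.card_inducedSep_le (hT : IsIET s l r len π T) (u v : ℝ) :
    (inducedSep l len T u v).card ≤ s + 2 := by
  classical
  have h1 : (breakPts l len u v).card ≤ (interiorSep l len).card + 1 + 1 :=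
    (Finset.card_insert_le _ _).trans (Nat.succ_le_succ (Finset.card_insert_le _ _))
  have h2 := hT.card_interiorSep
  refine (Finset.card_insert_le _ _).trans ?_
  have h3 := (Finset.card_filter_le ((breakPts l len u v).image
    fun p => (T⁻¹ ^ rhoMinusPt T u v p) p) fun q => q ∈ Set.Ioo u v).trans Finset.card_image_le
  omega

theorem inducedSep_subset {u v : ℝ} (huv : u < v) {q : ℝ} (hq : q ∈ inducedSep l len T u v) :
    q ∈ Set.Ico u v := by
  rcases Finset.mem_insert.1 hq with rfl | hq
  · exact ⟨le_rfl, huv⟩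
  · exact Set.Ioo_subset_Ico_self (Finset.mem_filter.1 hq).2

theorem mem_inducedSep {u v p q : ℝ} {n : ℕ} (hp : p ∈ breakPts l len u v) (hqp : (T ^ n) q = p)
    (hq : q ∈ Set.Ioo u v) (hp0 : 0 < n → p ∉ Set.Ioo u v)
    (hn : ∀ j, 0 < j → j < n → (T ^ j) q ∉ Set.Ioo u v) : q ∈ inducedSep l len T u v := by
  have hback : ∀ j ≤ n, (T⁻¹ ^ j) p = (T ^ (n - j)) q := by
    intro j hj
    rw [inv_pow, Equiv.Perm.inv_eq_iff_eq, ← Equiv.Perm.mul_apply, ← pow_add,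
      Nat.add_sub_cancel' hj, hqp]
  have hρ : rhoMinusPt T u v p = n := by
    have hmem : n ∈ {n : ℕ | (T⁻¹ ^ n) p ∈ Set.Ioo u v} := by
      rwa [Set.mem_ofPred_eq, hback n le_rfl, Nat.sub_self]
    refine le_antisymm (Nat.sInf_le hmem) (le_csInf ⟨n, hmem⟩ fun j hj => ?_)
    by_contra! hjn
    rw [Set.mem_ofPred_eq, hback j hjn.le] at hj
    rcases Nat.eq_zero_or_pos j with rfl | hj0
    · rw [Nat.sub_zero, hqp] at hj
      exact hp0 hjn hj
    · exact hn (n - j) (by omega) (by omega) hj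
  refine Finset.mem_insert_of_mem (Finset.mem_filter.2 ⟨Finset.mem_image.2 ⟨p, hp, ?_⟩, hq⟩)
  rw [hρ, hback n le_rfl, Nat.sub_self]
  rfl

section Piece

variable {u v a b : ℝ}

/-- No break point lies in the interior of the `n`-th image of a piece before its return. -/
theorem notMem_Ioo_of_mem_breakPts (hua : u ≤ a) (hbv : b ≤ v)
    (hab' : ∀ q ∈ inducedSep l len T u v, q ∉ Set.Ioo a b) {n : ℕ} {c : ℝ}
    (hc : ∀ z ∈ Set.Ico a b, (T ^ n) z = z + c)
    (hn : ∀ j, 0 < j → j < n → ∀ z ∈ Set.Ico a b, (T ^ j) z ∉ Set.Ico u v)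
    {p : ℝ} (hp : p ∈ breakPts l len u v) (hp0 : 0 < n → p ∉ Set.Ioo u v) :
    p ∉ Set.Ioo (a + c) (b + c) := by
  intro hpi
  have hq : p - c ∈ Set.Ioo a b := ⟨by linarith [hpi.1], by linarith [hpi.2]⟩
  have hq' := Set.Ioo_subset_Ico_self hq
  refine hab' (p - c) (mem_inducedSep (n := n) hp ?_ (Set.Ioo_subset_Ioo hua hbv hq) hp0 ?_) hq
  · rw [hc _ hq', sub_add_cancel]
  · exact fun j h0 hj h => hn j h0 hj _ hq' (Set.Ioo_subset_Ico_self h)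

theorem IsIET.exists_pow_translation (hT : IsIET s l r len π T) (hlu : l ≤ u) (hvr : v ≤ r)
    (hua : u ≤ a) (hab : a < b) (hbv : b ≤ v)
    (hab' : ∀ q ∈ inducedSep l len T u v, q ∉ Set.Ioo a b) (n : ℕ)
    (hn : ∀ j, 0 < j → j < n → ∀ z ∈ Set.Ico a b, (T ^ j) z ∉ Set.Ico u v) :
    ∃ c, ∀ z ∈ Set.Ico a b, (T ^ n) z = z + c := by
  induction n with
  | zero => exact ⟨0, fun z _ => by simp⟩
  | succ n ih =>
    obtain ⟨c, hc⟩ := ih fun j h0 hj => hn j h0 (hj.trans n.lt_succ_self)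
    have hlr : Set.Ico (a + c) (b + c) ⊆ Set.Ico l r := by
      intro y hy
      have hy' : y - c ∈ Set.Ico a b := ⟨by linarith [hy.1], by linarith [hy.2]⟩
      have h1 := hT.pow_apply_mem n (Set.Ico_subset_Ico (hlu.trans hua) (hbv.trans hvr) hy')
      rwa [hc _ hy', sub_add_cancel] at h1
    obtain ⟨h1, h2⟩ := (Set.Ico_subset_Ico_iff (by linarith)).1 hlr
    obtain ⟨d, hd⟩ := hT.exists_translation h1 h2 fun p hp hpi => by
      refine notMem_Ioo_of_mem_breakPts hua hbv hab' hc
        (fun j h0 hj => hn j h0 (hj.trans n.lt_succ_self))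
        (Finset.mem_insert_of_mem (Finset.mem_insert_of_mem hp)) (fun h0 hpuv => ?_) hpi
      have hq : p - c ∈ Set.Ico a b := ⟨by linarith [hpi.1], by linarith [hpi.2]⟩
      refine hn n h0 n.lt_succ_self _ hq ?_
      rw [hc _ hq, sub_add_cancel]
      exact Set.Ioo_subset_Ico_self hpuv
    refine ⟨c + d, fun z hz => ?_⟩
    rw [pow_succ', Equiv.Perm.mul_apply, hc z hz, hd _ ⟨by linarith [hz.1], by linarith [hz.2]⟩]
    ring

/-- By finiteness of length, every piece meets `[u,v)` again. -/
theorem IsIET.exists_return (hT : IsIET s l r len π T) (hlu : l ≤ u) (hvr : v ≤ r)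
    (hua : u ≤ a) (hab : a < b) (hbv : b ≤ v)
    (hab' : ∀ q ∈ inducedSep l len T u v, q ∉ Set.Ioo a b) :
    ∃ n, 0 < n ∧ ∃ z ∈ Set.Ico a b, (T ^ n) z ∈ Set.Ico u v := by
  by_contra! hno
  choose c hc using fun n => hT.exists_pow_translation hlu hvr hua hab hbv hab' n
    fun j h0 _ => hno j h0
  have hpre : ∀ n, ∀ y ∈ Set.Ico (a + c n) (a + c n + (b - a)),
      y - c n ∈ Set.Ico a b ∧ (T ^ n) (y - c n) = y := by
    intro n y hy
    have h : y - c n ∈ Set.Ico a b := ⟨by linarith [hy.1], by linarith [hy.2]⟩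
    exact ⟨h, by rw [hc n _ h, sub_add_cancel]⟩
  have hdlt : ∀ i j, i < j → Disjoint (Set.Ico (a + c i) (a + c i + (b - a)))
      (Set.Ico (a + c j) (a + c j + (b - a))) := by
    intro i j hij
    refine Set.disjoint_left.2 fun y hi hj => ?_
    obtain ⟨h1, h2⟩ := hpre i y hi
    obtain ⟨h3, h4⟩ := hpre j y hj
    refine hno (j - i) (Nat.sub_pos_of_lt hij) _ h3 ?_
    have : (T ^ (j - i)) (y - c j) = y - c i := by
      apply (T ^ i).injective
      rw [← Equiv.Perm.mul_apply, ← pow_add, Nat.add_sub_cancel' hij.le, h4, h2]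
    rw [this]
    exact Set.Ico_subset_Ico hua hbv h1
  obtain ⟨N, hN⟩ := exists_nat_gt ((r - l) / (b - a))
  have hsum := sum_le_of_pairwiseDisjoint_Ico (A := Finset.range N) (x := fun n => a + c n)
    (lam := fun _ => b - a) hT.1.le (fun _ _ => (sub_pos.2 hab).le)
    (fun i _ j _ hij => (lt_or_gt_of_ne hij).elim (hdlt i j) fun h => (hdlt j i h).symm)
    fun n _ y hy => by
      obtain ⟨h1, h2⟩ := hpre n y hy
      exact h2 ▸ hT.pow_apply_mem n (Set.Ico_subset_Ico (hlu.trans hua) (hbv.trans hvr) h1)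
  rw [div_lt_iff₀ (sub_pos.2 hab)] at hN
  simp only [Finset.sum_const, Finset.card_range, nsmul_eq_mul] at hsum
  linarith

theorem returnTime_eq_s2 {I : Set ℝ} {z : ℝ} {n : ℕ} (h0 : 0 < n) (hn : (T ^ n) z ∈ I)
    (hlt : ∀ j, 0 < j → j < n → (T ^ j) z ∉ I) : returnTime T I z = n :=
  le_antisymm (Nat.sInf_le ⟨h0, hn⟩) (le_csInf ⟨n, h0, hn⟩ fun j hj => by
    by_contra! h
    exact hlt j hj.1 h hj.2)

/-- The induced map is a translation on each piece, with constant return time. -/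
theorem IsIET.exists_inducedMap_translation (hT : IsIET s l r len π T) (hlu : l ≤ u) (hvr : v ≤ r)
    (hua : u ≤ a) (hab : a < b) (hbv : b ≤ v)
    (hab' : ∀ q ∈ inducedSep l len T u v, q ∉ Set.Ioo a b) :
    ∃ c, ∀ z ∈ Set.Ico a b, inducedMap T (Set.Ico u v) z = z + c ∧
      ∃ n, 0 < n ∧ (T ^ n) z ∈ Set.Ico u v := by
  classical
  have hex := hT.exists_return hlu hvr hua hab hbv hab'
  obtain ⟨hn0, z₀, hz₀, hz₀r⟩ := Nat.find_spec hex
  have hlt : ∀ j, 0 < j → j < Nat.find hex → ∀ z ∈ Set.Ico a b, (T ^ j) z ∉ Set.Ico u v :=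
    fun j h0 hj z hz h => Nat.find_min hex hj ⟨h0, z, hz, h⟩
  generalize Nat.find hex = n at hn0 hz₀r hlt
  obtain ⟨c, hc⟩ := hT.exists_pow_translation hlu hvr hua hab hbv hab' n hlt
  have hu := notMem_Ioo_of_mem_breakPts (len := len) hua hbv hab' hc hlt
    (p := u) (Finset.mem_insert_self _ _) fun _ h => lt_irrefl _ h.1
  have hv := notMem_Ioo_of_mem_breakPts (len := len) hua hbv hab' hc hlt
    (p := v) (Finset.mem_insert_of_mem (Finset.mem_insert_self _ _)) fun _ h => lt_irrefl _ h.2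
  rw [hc z₀ hz₀] at hz₀r
  have hau : u ≤ a + c := by
    by_contra! h
    exact hu ⟨h, by linarith [hz₀.2, hz₀r.1]⟩
  have hbv' : b + c ≤ v := by
    by_contra! h
    exact hv ⟨by linarith [hz₀.1, hz₀r.2], h⟩
  refine ⟨c, fun z hz => ?_⟩
  have hzr : (T ^ n) z ∈ Set.Ico u v := by
    rw [hc z hz]
    exact ⟨by linarith [hz.1], by linarith [hz.2]⟩
  refine ⟨?_, n, hn0, hzr⟩
  rw [inducedMap, returnTime_eq_s2 hn0 hzr fun j h0 hj => hlt j h0 hj z hz, hc z hz]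

end Piece

end IET

theorem injOn_inducedMap {T : Equiv.Perm ℝ} {I : Set ℝ}
    (h : ∀ z ∈ I, ∃ n, 0 < n ∧ (T ^ n) z ∈ I) : Set.InjOn (inducedMap T I) I := by
  have key : ∀ z ∈ I, ∀ w ∈ I, inducedMap T I z = inducedMap T I w →
      returnTime T I z ≤ returnTime T I w → z = w := by
    intro z hz w hw hzw hle
    have h1 : (T ^ (returnTime T I w - returnTime T I z)) w = z := by
      apply (T ^ returnTime T I z).injective
      rw [← Equiv.Perm.mul_apply, ← pow_add, Nat.add_sub_cancel' hle]
      exact hzw.symm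
    have hpos : 0 < returnTime T I z := (Nat.sInf_mem (h z hz)).1
    rcases hle.eq_or_lt with heq | hlt
    · rw [heq, Nat.sub_self] at h1
      exact h1.symm
    · exact absurd ⟨Nat.sub_pos_of_lt hlt, h1.symm ▸ hz⟩
        (Nat.notMem_of_lt_sInf (Nat.sub_lt (hpos.trans hlt) hpos))
  intro z hz w hw hzw
  rcases le_total (returnTime T I z) (returnTime T I w) with hle | hle
  · exact key z hz w hw hzw hle
  · exact (key w hw z hz hzw.symm hle).symm

/-- In a finite set of points of `(-∞,v)`, every point has a successor, `v` being the last. -/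
theorem exists_successor (B : Finset ℝ) {v x : ℝ} (hx : x < v) :
    ∃ y, x < y ∧ y ≤ v ∧ (y = v ∨ y ∈ B) ∧ ∀ q ∈ B, q ∉ Set.Ioo x y := by
  obtain ⟨y, hy, hmin⟩ := Finset.exists_min_image (insert v (B.filter fun q => x < q)) id
    ⟨v, Finset.mem_insert_self _ _⟩
  refine ⟨y, ?_, hmin v (Finset.mem_insert_self _ _),
    (Finset.mem_insert.1 hy).imp_right fun h => (Finset.mem_filter.1 h).1, fun q hq hxy => ?_⟩
  · rcases Finset.mem_insert.1 hy with rfl | hy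
    · exact hx
    · exact (Finset.mem_filter.1 hy).2
  · exact absurd (hmin q (Finset.mem_insert_of_mem (Finset.mem_filter.2 ⟨hq, hxy.1⟩)))
      (not_le.2 hxy.2)

/-- The transformation induced by a minimal `s`-interval exchange
transformation on any semi-interval `[u,v) ⊆ [l,r)` is an interval exchange
transformation on at most `s + 2` semi-intervals. -/
theorem induced_iet_card_le (s : ℕ) (l r : ℝ) (len : Fin s → ℝ)
    (π : Equiv.Perm (Fin s)) (T : Equiv.Perm ℝ)
    (hIET : IsIET s l r len π T) (hmin : IsMinimalOn T l r)
    (u v : ℝ) (hlu : l ≤ u) (huv : u < v) (hvr : v ≤ r) :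
    ∃ k : ℕ, k ≤ s + 2 ∧ ∃ (lam : Fin k → ℝ) (σ : Equiv.Perm (Fin k)),
      InducedData T u v k lam σ := by
  set e := (inducedSep l len T u v).orderEmbOfFin rfl with he
  have hmem : ∀ i, e i ∈ inducedSep l len T u v := Finset.orderEmbOfFin_mem _ rfl
  have hrange : ∀ q ∈ inducedSep l len T u v, ∃ i, e i = q := fun q hq => by
    rw [← Set.mem_range, he, Finset.range_orderEmbOfFin]
    exact hq
  have huv' : ∀ i, e i ∈ Set.Ico u v := fun i => inducedSep_subset huv (hmem i)
  choose y hey hyv hymem hy using fun i => exists_successor (inducedSep l len T u v) (huv' i).2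
  choose c hc using fun i => hIET.exists_inducedMap_translation hlu hvr (huv' i).1 (hey i)
    (hyv i) (hy i)
  have hadd : ∀ i, e i + (y i - e i) = y i := fun i => add_sub_cancel _ _
  have hcover : ∀ z ∈ Set.Ico u v, ∃ i, z ∈ Set.Ico (e i) (y i) := by
    intro z hz
    obtain ⟨x, hx, hmax⟩ := Finset.exists_max_image
      ((inducedSep l len T u v).filter fun q => q ≤ z) id
      ⟨u, Finset.mem_filter.2 ⟨Finset.mem_insert_self _ _, hz.1⟩⟩
    obtain ⟨hxB, hxz⟩ := Finset.mem_filter.1 hx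
    obtain ⟨i, rfl⟩ := hrange x hxB
    refine ⟨i, hxz, ?_⟩
    by_contra! hyz
    rcases hymem i with h | h
    · exact absurd hz.2 (not_lt.2 (h ▸ hyz))
    · exact absurd (hmax _ (Finset.mem_filter.2 ⟨h, hyz⟩)) (not_le.2 (hey i))
  have hle : ∀ i j, i < j → y i ≤ e j := fun i j hij => by
    by_contra! h
    exact hy i _ (hmem j) ⟨e.strictMono hij, h⟩
  have hreturn : ∀ z ∈ Set.Ico u v, ∃ n, 0 < n ∧ (T ^ n) z ∈ Set.Ico u v := fun z hz => by
    obtain ⟨i, hi⟩ := hcover z hz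
    exact (hc i z hi).2
  obtain ⟨σ, S, hS⟩ := exists_isIET_of_piecewise_translation (lam := fun i => y i - e i)
    (f := inducedMap T (Set.Ico u v)) huv e.strictMono (fun i => sub_pos.2 (hey i))
    (fun i j hij => by
      simp only [hadd]
      refine Set.disjoint_left.2 fun z hi hj => ?_
      rcases lt_or_gt_of_ne hij with h | h
      · linarith [hle i j h, hi.2, hj.1]
      · linarith [hle j i h, hj.2, hi.1])
    (by
      simp only [hadd]
      refine Set.Subset.antisymm (Set.iUnion_subset fun i =>
        Set.Ico_subset_Ico (huv' i).1 (hyv i)) fun z hz => Set.mem_iUnion.2 (hcover z hz))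
    (fun i z hz => (hc i z (by rwa [hadd] at hz)).1)
    (fun z hz => (Nat.sInf_mem (hreturn z hz)).2) (injOn_inducedMap hreturn)
  exact ⟨_, hIET.card_inducedSep_le u v, _, σ, S, hS⟩

end
end
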